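/- arXiv:1006.3970 — 2 statements merged into one kernel-verified Lean document; each statement's English description precedes it below -/
import Mathlib

section
/- For every integer r > 0 there exists a constant c_r > 0 such that the following holds. Let G = (V,E) be a graph on n vertices (identify V with {1,…,n}) admitting a tree decomposition of width at most r, and let y = (y_I) be a vector in SA_{r+3}(n) with y_∅ > 0 and y_{I,J} = y_{J,I} for all I,J with |I ∪ J| ≤ r+3. Then there exists a probability distribution over functions f : V → {0,1} such that: (i) for every edge (i,j) ∈ E, Pr[f(i) ≠ f(j)] = ỹ_{i≠j}; and (ii) for every pair of vertices i, j ∈ V, Pr[f(i) ≠ f(j)] ≥ c_r · ỹ_{i≠j}. -/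
open Finset

/-- `y_{I,J} = ∑_{I' ⊆ I} (-1)^{|I'|} y_{I' ∪ J}`. -/
def saIJ {n : ℕ} (y : Finset (Fin n) → ℝ) (I J : Finset (Fin n)) : ℝ :=
  ∑ I' ∈ I.powerset, (-1 : ℝ) ^ I'.card * y (I' ∪ J)

/-- Membership in the Sherali–Adams polytope `SA_t(n)`. -/
def memSA {n : ℕ} (t : ℕ) (y : Finset (Fin n) → ℝ) : Prop :=
  ∀ I J : Finset (Fin n), (I ∪ J).card ≤ t → 0 ≤ saIJ y I J

/-- `y_{i≠j} = y_{{i},{j}} + y_{{j},{i}}`. -/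
def yNeq {n : ℕ} (y : Finset (Fin n) → ℝ) (i j : Fin n) : ℝ :=
  saIJ y {i} {j} + saIJ y {j} {i}

/-- A tree decomposition of a graph `G`: a family of bags indexed by the nodes of a tree
(a connected acyclic graph), covering all vertices and edges, such that for each vertex the
bags containing it induce a connected subtree. -/
structure TreeDecomp {V : Type} (G : SimpleGraph V) where
  ι : Type
  fintype_ι : Fintype ι
  T : SimpleGraph ι
  connected : T.Connected
  acyclic : T.IsAcyclic
  bags : ι → Finset V
  covers_vertices : ∀ v : V, ∃ i, v ∈ bags i
  covers_edges : ∀ u v : V, G.Adj u v → ∃ i, u ∈ bags i ∧ v ∈ bags i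
  bags_connected : ∀ v : V, (T.induce {i | v ∈ bags i}).Connected

section ReverseMartingale

variable {Ω : Type*} [Fintype Ω] {ν ψ : ℕ → Ω → ℝ} {m : ℕ}

/-- Weights `ν k` and functions `ψ k` such that, up to time `m`, the law of `ψ (k + 1)` is the
same under `ν k` and `ν (k + 1)`, and `ψ (k + 1)` is the conditional expectation of `ψ k` given
`ψ (k + 1)` under `ν k`. -/
structure IsReverseMartingale (ν ψ : ℕ → Ω → ℝ) (m : ℕ) : Prop where
  nonneg : ∀ k ω, 0 ≤ ν k ω
  shift : ∀ k < m, ∀ g : ℝ → ℝ,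
    ∑ ω, ν (k + 1) ω * g (ψ (k + 1) ω) = ∑ ω, ν k ω * g (ψ (k + 1) ω)
  mart : ∀ k < m, ∀ g : ℝ → ℝ,
    ∑ ω, ν k ω * ((ψ k ω - ψ (k + 1) ω) * g (ψ (k + 1) ω)) = 0

/-- The quadratic variation of the step from `k` to `k + 1`. -/
def stepEnergy (ν ψ : ℕ → Ω → ℝ) (k : ℕ) : ℝ :=
  ∑ ω, ν k ω * (ψ k ω - ψ (k + 1) ω) ^ 2

/-- The mass of the points at which `ψ k` lies in the open interval `(a, b)`. -/
noncomputable def levelMass (ν ψ : ℕ → Ω → ℝ) (a b : ℝ) (k : ℕ) : ℝ :=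
  ∑ ω, ν k ω * if a < ψ k ω ∧ ψ k ω < b then 1 else 0

/-- The number of values of `ψ k` in the open interval `(a, b)`. -/
noncomputable def levelCount (ψ : ℕ → Ω → ℝ) (a b : ℝ) (k : ℕ) : ℕ :=
  ((univ.image (ψ k)).filter fun x => a < x ∧ x < b).card

/-- The mass crossing the moving threshold `θ` downwards between times `k` and `k + 1`. -/
noncomputable def crossMass (ν ψ : ℕ → Ω → ℝ) (θ : ℕ → ℝ) (k : ℕ) : ℝ :=
  ∑ ω, ν k ω * if θ k < ψ k ω ∧ ψ (k + 1) ω ≤ θ (k + 1) then 1 else 0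

/-- Some moving threshold in `(a, b)` is crossed downwards by mass at most `K` during `[s, t]`. -/
def HasCut (ν ψ : ℕ → Ω → ℝ) (a b : ℝ) (s t : ℕ) (K : ℝ) : Prop :=
  ∃ θ : ℕ → ℝ, (∀ k, s ≤ k → k ≤ t → a < θ k ∧ θ k < b) ∧
    ∑ k ∈ Ico s t, crossMass ν ψ θ k ≤ K

lemma HasCut.mono {a b a' b' : ℝ} {s t : ℕ} {K K' : ℝ} (h : HasCut ν ψ a b s t K)
    (ha : a' ≤ a) (hb : b ≤ b') (hK : K ≤ K') : HasCut ν ψ a' b' s t K' := by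
  obtain ⟨θ, h1, h2⟩ := h
  refine ⟨θ, fun k hs ht => ?_, h2.trans hK⟩
  have := h1 k hs ht
  exact ⟨by linarith, by linarith⟩

namespace IsReverseMartingale

lemma stepEnergy_nonneg (H : IsReverseMartingale ν ψ m) (k : ℕ) : 0 ≤ stepEnergy ν ψ k :=
  sum_nonneg fun ω _ => mul_nonneg (H.nonneg k ω) (sq_nonneg _)

lemma levelMass_nonneg (H : IsReverseMartingale ν ψ m) (a b : ℝ) (k : ℕ) :
    0 ≤ levelMass ν ψ a b k :=
  sum_nonneg fun ω _ => mul_nonneg (H.nonneg k ω) (by split_ifs <;> norm_num)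

lemma sum_succ_le (H : IsReverseMartingale ν ψ m) {h g : ℝ → ℝ} {B : ℝ}
    (hB : ∀ u v, h u + g u * (v - u) - B * (v - u) ^ 2 ≤ h v) {k : ℕ} (hk : k < m) :
    ∑ ω, ν (k + 1) ω * h (ψ (k + 1) ω) ≤ ∑ ω, ν k ω * h (ψ k ω) + B * stepEnergy ν ψ k := by
  rw [H.shift k hk h]
  have h0 := H.mart k hk g
  have : ∑ ω, ν k ω * h (ψ (k + 1) ω)
      + ∑ ω, ν k ω * ((ψ k ω - ψ (k + 1) ω) * g (ψ (k + 1) ω))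
      ≤ ∑ ω, ν k ω * h (ψ k ω) + B * stepEnergy ν ψ k := by
    rw [stepEnergy, mul_sum, ← sum_add_distrib, ← sum_add_distrib]
    refine sum_le_sum fun ω _ => ?_
    have := mul_le_mul_of_nonneg_left (hB (ψ (k + 1) ω) (ψ k ω)) (H.nonneg k ω)
    nlinarith
  linarith

lemma sum_le_add_energy (H : IsReverseMartingale ν ψ m) {h g : ℝ → ℝ} {B : ℝ}
    (hB : ∀ u v, h u + g u * (v - u) - B * (v - u) ^ 2 ≤ h v) {s t : ℕ} (hst : s ≤ t)
    (ht : t ≤ m) :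
    ∑ ω, ν t ω * h (ψ t ω)
      ≤ ∑ ω, ν s ω * h (ψ s ω) + B * ∑ k ∈ Ico s t, stepEnergy ν ψ k := by
  induction t, hst using Nat.le_induction with
  | base => simp
  | succ t hst ih =>
    have h1 := ih (by omega)
    have h2 := H.sum_succ_le hB (k := t) (by omega)
    rw [sum_Ico_succ_top hst]
    linarith

/-- The threshold jumps inside the interval at the cost of the energy of the step and of the mass
in the interval after it. -/
lemma crossMass_le (H : IsReverseMartingale ν ψ m) {θ : ℕ → ℝ} {a b ε : ℝ} (hε : 0 < ε) {k : ℕ}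
    (hk : k < m) (h1 : a + ε ≤ θ k) (h2 : θ (k + 1) < b) :
    crossMass ν ψ θ k ≤ 1 / ε ^ 2 * stepEnergy ν ψ k + levelMass ν ψ a b (k + 1) := by
  rw [levelMass, H.shift k hk fun x => if a < x ∧ x < b then 1 else 0, stepEnergy, mul_sum,
    ← sum_add_distrib, crossMass]
  refine sum_le_sum fun ω _ => ?_
  have key : (if θ k < ψ k ω ∧ ψ (k + 1) ω ≤ θ (k + 1) then (1 : ℝ) else 0)
      ≤ 1 / ε ^ 2 * (ψ k ω - ψ (k + 1) ω) ^ 2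
        + (if a < ψ (k + 1) ω ∧ ψ (k + 1) ω < b then 1 else 0) := by
    have h0 : 0 ≤ 1 / ε ^ 2 * (ψ k ω - ψ (k + 1) ω) ^ 2 := by positivity
    split_ifs with hc hi hi
    · linarith
    · have ha : ψ (k + 1) ω ≤ a := by
        by_contra! hlt
        exact hi ⟨hlt, by linarith [hc.2]⟩
      have : ε ^ 2 ≤ (ψ k ω - ψ (k + 1) ω) ^ 2 :=
        pow_le_pow_left₀ hε.le (by linarith [hc.1]) 2
      have : 1 ≤ 1 / ε ^ 2 * (ψ k ω - ψ (k + 1) ω) ^ 2 := by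
        rw [one_div_mul_eq_div, le_div_iff₀ (by positivity)]
        linarith
      linarith
    · linarith
    · linarith
  have := mul_le_mul_of_nonneg_left key (H.nonneg k ω)
  linarith

lemma hasCut_of_levelCount_eq_zero (H : IsReverseMartingale ν ψ m) {a ρ : ℝ} (hρ : 0 < ρ)
    {s t : ℕ} (ht : t ≤ m)
    (hc : ∀ k, s ≤ k → k ≤ t → levelCount ψ a (a + 10 * ρ) k = 0) :
    HasCut ν ψ a (a + 10 * ρ) s t (1 / (4 * ρ ^ 2) * ∑ k ∈ Ico s t, stepEnergy ν ψ k) := by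
  refine ⟨fun _ => a + 5 * ρ, fun k _ _ => ⟨by linarith, by linarith⟩, ?_⟩
  rw [mul_sum]
  refine sum_le_sum fun k hk => ?_
  rw [Finset.mem_Ico] at hk
  have h1 := H.crossMass_le (θ := fun _ => a + 5 * ρ) (a := a) (b := a + 10 * ρ)
    (ε := 2 * ρ) (k := k) (by linarith) (by omega) (by simp; linarith) (by simp; linarith)
  have h2 : levelMass ν ψ a (a + 10 * ρ) (k + 1) = 0 := by
    have := hc (k + 1) (by omega) (by omega)
    rw [levelCount, card_eq_zero, filter_eq_empty_iff] at this
    refine sum_eq_zero fun ω _ => ?_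
    rw [if_neg (this (mem_image_of_mem _ (mem_univ ω))), mul_zero]
  have h3 : (2 * ρ) ^ 2 = 4 * ρ ^ 2 := by ring
  rw [h2, h3] at h1
  linarith

/-- Concatenation of two cuts, with a jump in the step between them. -/
lemma hasCut_append (H : IsReverseMartingale ν ψ m) {a b a₁ b₁ a₂ b₂ ε : ℝ} (hε : 0 < ε)
    {s u t : ℕ} (hsu : s ≤ u) (hut : u + 1 ≤ t) (ht : t ≤ m) {K₁ K₂ : ℝ}
    (h₁ : HasCut ν ψ a₁ b₁ s u K₁) (h₂ : HasCut ν ψ a₂ b₂ (u + 1) t K₂)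
    (ha₁ : a + ε ≤ a₁) (hb₁ : b₁ ≤ b) (ha₂ : a ≤ a₂) (hb₂ : b₂ ≤ b) :
    HasCut ν ψ a b s t
      (K₁ + (1 / ε ^ 2 * stepEnergy ν ψ u + levelMass ν ψ a b (u + 1)) + K₂) := by
  obtain ⟨θ₁, hθ₁, hK₁⟩ := h₁
  obtain ⟨θ₂, hθ₂, hK₂⟩ := h₂
  let θ : ℕ → ℝ := fun k => if k ≤ u then θ₁ k else θ₂ k
  have e1 : ∀ k, k ≤ u → θ k = θ₁ k := fun k hk => if_pos hk
  have e2 : ∀ k, u < k → θ k = θ₂ k := fun k hk => if_neg (by omega)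
  refine ⟨θ, fun k hs hk => ?_, ?_⟩
  · rcases le_or_gt k u with h | h
    · rw [e1 k h]
      have := hθ₁ k hs h
      exact ⟨by linarith, by linarith⟩
    · rw [e2 k h]
      have := hθ₂ k h hk
      exact ⟨by linarith, by linarith⟩
  · rw [← sum_Ico_consecutive _ (show s ≤ u + 1 by omega) hut, sum_Ico_succ_top hsu]
    have hu := H.crossMass_le (θ := θ) (a := a) (b := b) hε (k := u) (by omega)
      (by rw [e1 u le_rfl]; linarith [hθ₁ u hsu le_rfl])
      (by rw [e2 (u + 1) (by omega)]; linarith [hθ₂ (u + 1) le_rfl hut])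
    have s1 : ∑ k ∈ Ico s u, crossMass ν ψ θ k = ∑ k ∈ Ico s u, crossMass ν ψ θ₁ k := by
      refine sum_congr rfl fun k hk => ?_
      rw [Finset.mem_Ico] at hk
      simp only [crossMass, e1 k hk.2.le, e1 (k + 1) hk.2]
    have s2 : ∑ k ∈ Ico (u + 1) t, crossMass ν ψ θ k
        = ∑ k ∈ Ico (u + 1) t, crossMass ν ψ θ₂ k := by
      refine sum_congr rfl fun k hk => ?_
      rw [Finset.mem_Ico] at hk
      simp only [crossMass, e2 k (by omega), e2 (k + 1) (by omega)]
    rw [s1, s2]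
    linarith

end IsReverseMartingale

/-- A bump equal to at least `1` within `ρ` of `c` and vanishing beyond `3ρ`. -/
noncomputable def bump (c ρ x : ℝ) : ℝ := max 0 ((9 - ((x - c) / ρ) ^ 2) / 8)

lemma bump_nonneg (c ρ x : ℝ) : 0 ≤ bump c ρ x := le_max_left _ _

lemma bump_le (c ρ x : ℝ) : bump c ρ x ≤ 2 :=
  max_le (by norm_num) (by nlinarith [sq_nonneg ((x - c) / ρ)])

lemma one_le_bump {c ρ x : ℝ} (hρ : 0 < ρ) (h : |x - c| ≤ ρ) : 1 ≤ bump c ρ x := by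
  refine le_max_of_le_right ?_
  have : ((x - c) / ρ) ^ 2 ≤ 1 := by
    rw [div_pow, div_le_one (by positivity)]
    exact sq_le_sq' (by linarith [neg_abs_le (x - c)]) (by linarith [le_abs_self (x - c)])
  linarith

lemma bump_eq_zero {c ρ x : ℝ} (hρ : 0 < ρ) (h : 3 * ρ ≤ |x - c|) : bump c ρ x = 0 := by
  refine max_eq_left ?_
  have : 9 ≤ ((x - c) / ρ) ^ 2 := by
    rw [div_pow, le_div_iff₀ (by positivity), ← sq_abs (x - c)]
    nlinarith
  linarith

lemma exists_bump_semiconvex {c ρ : ℝ} (hρ : 0 < ρ) : ∃ g : ℝ → ℝ, ∀ u v,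
    bump c ρ u + g u * (v - u) - 1 / (8 * ρ ^ 2) * (v - u) ^ 2 ≤ bump c ρ v := by
  refine ⟨fun u => if bump c ρ u = 0 then 0 else -((u - c) / ρ ^ 2) / 4, fun u v => ?_⟩
  have hB : 0 ≤ 1 / (8 * ρ ^ 2) * (v - u) ^ 2 := by positivity
  dsimp only
  split_ifs with h
  · linarith [bump_nonneg c ρ v]
  · have hu : bump c ρ u = (9 - ((u - c) / ρ) ^ 2) / 8 := by
      unfold bump at h ⊢
      rcases max_choice 0 ((9 - ((u - c) / ρ) ^ 2) / 8) with h' | h'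
      · exact absurd h' h
      · exact h'
    have hv : (9 - ((v - c) / ρ) ^ 2) / 8 ≤ bump c ρ v := le_max_right _ _
    rw [hu]
    refine le_trans (le_of_eq ?_) hv
    field_simp
    ring

lemma levelCount_add_le {ψ : ℕ → Ω → ℝ} {a b a₁ b₁ a₂ b₂ : ℝ} (ha₁ : a ≤ a₁) (h₁₂ : b₁ ≤ a₂)
    (hb₂ : b₂ ≤ b) (h₁ : a₁ ≤ b₁) (h₂ : a₂ ≤ b₂) (k : ℕ) :
    levelCount ψ a₁ b₁ k + levelCount ψ a₂ b₂ k ≤ levelCount ψ a b k := by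
  unfold levelCount
  rw [← card_union_of_disjoint]
  · refine card_le_card fun x hx => ?_
    simp only [mem_union, mem_filter] at hx ⊢
    rcases hx with ⟨h, h3, h4⟩ | ⟨h, h3, h4⟩
    · exact ⟨h, by linarith, by linarith⟩
    · exact ⟨h, by linarith, by linarith⟩
  · rw [disjoint_filter]
    rintro x - ⟨_, h3⟩ ⟨h4, _⟩
    linarith

lemma mem_of_levelCount_le {ψ : ℕ → Ω → ℝ} {a b a₁ b₁ : ℝ} {k : ℕ} (ha : a ≤ a₁) (hb : b₁ ≤ b)
    (h : levelCount ψ a b k ≤ levelCount ψ a₁ b₁ k) {ω : Ω} (h1 : a < ψ k ω) (h2 : ψ k ω < b) :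
    a₁ < ψ k ω ∧ ψ k ω < b₁ := by
  have hsub : ((univ.image (ψ k)).filter fun x => a₁ < x ∧ x < b₁)
      ⊆ (univ.image (ψ k)).filter fun x => a < x ∧ x < b := by
    intro x hx
    simp only [mem_filter] at hx ⊢
    exact ⟨hx.1, by linarith, by linarith⟩
  have := eq_of_subset_of_card_le hsub h
  have hm : ψ k ω ∈ (univ.image (ψ k)).filter fun x => a < x ∧ x < b := by
    simp [h1, h2]
  rw [← this, mem_filter] at hm
  exact hm.2

/-- The constant in `IsReverseMartingale.hasCut`. -/
noncomputable def cutConst : ℕ → ℝ → ℝ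
  | 0, ρ => 1 / (4 * ρ ^ 2)
  | w + 1, ρ => 2 * (cutConst w (ρ / 5) + 1) + 3 / (8 * ρ ^ 2)

lemma cutConst_nonneg (w : ℕ) (ρ : ℝ) : 0 ≤ cutConst w ρ := by
  induction w generalizing ρ with
  | zero => unfold cutConst; positivity
  | succ w ih => have := ih (ρ / 5); unfold cutConst; positivity

namespace IsReverseMartingale

lemma levelMass_le_bump (H : IsReverseMartingale ν ψ m) {c ρ a b : ℝ} (hρ : 0 < ρ) {k : ℕ}
    (h : ∀ ω, a < ψ k ω → ψ k ω < b → c - ρ < ψ k ω ∧ ψ k ω < c + ρ) :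
    levelMass ν ψ a b k ≤ ∑ ω, ν k ω * bump c ρ (ψ k ω) := by
  refine sum_le_sum fun ω _ => mul_le_mul_of_nonneg_left ?_ (H.nonneg k ω)
  split_ifs with hω
  · have := h ω hω.1 hω.2
    exact one_le_bump hρ (abs_le.2 ⟨by linarith, by linarith⟩)
  · exact bump_nonneg _ _ _

/-- The induction step of `IsReverseMartingale.hasCut`: the threshold stays near one of the
centres `c`, `c'` until all values inside the interval are near it, then moves to the other. -/
lemma hasCut_step (H : IsReverseMartingale ν ψ m) {a ρ C : ℝ} {w : ℕ} (hρ : 0 < ρ) (hC : 0 ≤ C)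
    {t : ℕ} (ht : t ≤ m)
    (ih : ∀ (c : ℝ) (s u : ℕ), s ≤ u → u ≤ m →
      (∀ k, s ≤ k → k ≤ u → levelCount ψ (c - ρ) (c + ρ) k ≤ w) →
      HasCut ν ψ (c - ρ) (c + ρ) s u
        (C * (∑ k ∈ Ico s u, stepEnergy ν ψ k + levelMass ν ψ (c - ρ) (c + ρ) s)))
    (d : ℕ) : ∀ (s : ℕ) (c c' : ℝ), t = s + d →
      (c = a + 3 * ρ ∧ c' = a + 7 * ρ ∨ c = a + 7 * ρ ∧ c' = a + 3 * ρ) →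
      (∀ k, s ≤ k → k ≤ t → levelCount ψ a (a + 10 * ρ) k ≤ w + 1) →
      levelCount ψ (c - ρ) (c + ρ) s ≤ w →
      HasCut ν ψ a (a + 10 * ρ) s t ((C + 3 / (8 * ρ ^ 2)) * ∑ k ∈ Ico s t, stepEnergy ν ψ k
        + (C + 1) * ∑ ω, ν s ω * bump c ρ (ψ s ω)) := by
  induction d using Nat.strong_induction_on with
  | _ d ihd =>
  intro s c c' hd hcc hI hs
  have hca : a + 2 * ρ ≤ c - ρ ∧ c + ρ ≤ a + 8 * ρ := by
    rcases hcc with ⟨h, _⟩ | ⟨h, _⟩ <;> constructor <;> linarith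
  have hmass : levelMass ν ψ (c - ρ) (c + ρ) s ≤ ∑ ω, ν s ω * bump c ρ (ψ s ω) :=
    H.levelMass_le_bump hρ fun ω h1 h2 => ⟨h1, h2⟩
  have hbump : 0 ≤ ∑ ω, ν s ω * bump c ρ (ψ s ω) :=
    sum_nonneg fun ω _ => mul_nonneg (H.nonneg s ω) (bump_nonneg _ _ _)
  have hE : ∀ u v, 0 ≤ ∑ k ∈ Ico u v, stepEnergy ν ψ k := fun u v =>
    sum_nonneg fun k _ => H.stepEnergy_nonneg k
  by_cases hex : ∃ k, s ≤ k ∧ k ≤ t ∧ w < levelCount ψ (c - ρ) (c + ρ) k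
  · classical
    obtain ⟨hsu, hut, hw⟩ := Nat.find_spec hex
    have hmin := fun k => Nat.find_min hex (m := k)
    generalize Nat.find hex = u' at hsu hut hw hmin
    have hne : s ≠ u' := by
      rintro rfl
      omega
    obtain ⟨u, rfl⟩ : ∃ u, u' = u + 1 := ⟨u' - 1, by omega⟩
    have hIu := hI (u + 1) hsu hut
    have hin : ∀ ω, a < ψ (u + 1) ω → ψ (u + 1) ω < a + 10 * ρ →
        c - ρ < ψ (u + 1) ω ∧ ψ (u + 1) ω < c + ρ := fun ω =>
      mem_of_levelCount_le (by linarith) (by linarith) (by omega)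
    have h₁ := ih c s u (by omega) (by omega) fun k h1 h2 => by
      have := hmin k (by omega)
      by_contra! hlt
      exact this ⟨h1, by omega, hlt⟩
    have hc' : levelCount ψ (c' - ρ) (c' + ρ) (u + 1) ≤ w := by
      rcases hcc with ⟨h, h'⟩ | ⟨h, h'⟩
      · have := levelCount_add_le (ψ := ψ) (a := a) (b := a + 10 * ρ) (a₁ := c - ρ)
          (b₁ := c + ρ) (a₂ := c' - ρ) (b₂ := c' + ρ) (by linarith) (by linarith) (by linarith)
          (by linarith) (by linarith) (u + 1)
        omega
      · have := levelCount_add_le (ψ := ψ) (a := a) (b := a + 10 * ρ) (a₁ := c' - ρ)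
          (b₁ := c' + ρ) (a₂ := c - ρ) (b₂ := c + ρ) (by linarith) (by linarith) (by linarith)
          (by linarith) (by linarith) (u + 1)
        omega
    have h₂ := ihd (t - (u + 1)) (by omega) (u + 1) c' c (by omega)
      (by tauto) (fun k h1 h2 => hI k (by omega) h2) hc'
    have hz : ∑ ω, ν (u + 1) ω * bump c' ρ (ψ (u + 1) ω) = 0 := by
      refine sum_eq_zero fun ω _ => ?_
      rw [bump_eq_zero hρ, mul_zero]
      by_contra! hlt
      rw [abs_lt] at hlt
      rcases hcc with ⟨h, h'⟩ | ⟨h, h'⟩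
      · have := hin ω (by linarith) (by linarith)
        linarith
      · have := hin ω (by linarith) (by linarith)
        linarith
    obtain ⟨g, hg⟩ := exists_bump_semiconvex (c := c) hρ
    have hM : levelMass ν ψ a (a + 10 * ρ) (u + 1)
        ≤ ∑ ω, ν s ω * bump c ρ (ψ s ω)
          + 1 / (8 * ρ ^ 2) * ∑ k ∈ Ico s (u + 1), stepEnergy ν ψ k :=
      (H.levelMass_le_bump hρ hin).trans (H.sum_le_add_energy hg hsu (by omega))
    refine (H.hasCut_append (a := a) (b := a + 10 * ρ) (ε := 2 * ρ) (by linarith) (by omega)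
      hut ht h₁ h₂ (by linarith) (by linarith) le_rfl le_rfl).mono le_rfl le_rfl ?_
    rw [hz, ← sum_Ico_consecutive _ hsu hut]
    rw [sum_Ico_succ_top (by omega)] at hM ⊢
    set E₁ := ∑ k ∈ Ico s u, stepEnergy ν ψ k with hE₁
    have hE1 : 0 ≤ E₁ := hE s u
    have hEu := H.stepEnergy_nonneg u
    have e1 : 3 / (8 * ρ ^ 2) = 3 * (1 / (8 * ρ ^ 2)) := by ring
    have e2 : 1 / (2 * ρ) ^ 2 = 2 * (1 / (8 * ρ ^ 2)) := by field_simp; norm_num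
    have hD : 0 ≤ 1 / (8 * ρ ^ 2) := by positivity
    rw [e1, e2]
    set D := 1 / (8 * ρ ^ 2)
    have p1 := mul_le_mul_of_nonneg_left hmass hC
    have p2 := mul_nonneg hD hE1
    have p3 := mul_nonneg hC hEu
    nlinarith
  · push Not at hex
    refine (ih c s t (by omega) ht fun k h1 h2 => hex k h1 h2).mono (by linarith) (by linarith) ?_
    have h1 : 0 ≤ 3 / (8 * ρ ^ 2) * ∑ k ∈ Ico s t, stepEnergy ν ψ k :=
      mul_nonneg (by positivity) (hE s t)
    have h2 := mul_le_mul_of_nonneg_left hmass hC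
    linarith

/-- If `ψ` takes at most `w` values in an interval of length `10 ρ` at each time, then a moving
threshold in that interval is crossed downwards by little mass. -/
theorem hasCut (H : IsReverseMartingale ν ψ m) (w : ℕ) {ρ : ℝ} (hρ : 0 < ρ) (a : ℝ) {s t : ℕ}
    (hst : s ≤ t) (ht : t ≤ m)
    (hc : ∀ k, s ≤ k → k ≤ t → levelCount ψ a (a + 10 * ρ) k ≤ w) :
    HasCut ν ψ a (a + 10 * ρ) s t
      (cutConst w ρ * (∑ k ∈ Ico s t, stepEnergy ν ψ k + levelMass ν ψ a (a + 10 * ρ) s)) := by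
  induction w generalizing ρ a s t with
  | zero =>
    refine (H.hasCut_of_levelCount_eq_zero hρ ht fun k h1 h2 => by
      have := hc k h1 h2
      omega).mono le_rfl le_rfl ?_
    have h1 := mul_nonneg (cutConst_nonneg 0 ρ) (H.levelMass_nonneg a (a + 10 * ρ) s)
    simp only [cutConst] at h1 ⊢
    linarith
  | succ w ih =>
    have hC := cutConst_nonneg w (ρ / 5)
    have ih' : ∀ (c : ℝ) (s u : ℕ), s ≤ u → u ≤ m →
        (∀ k, s ≤ k → k ≤ u → levelCount ψ (c - ρ) (c + ρ) k ≤ w) →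
        HasCut ν ψ (c - ρ) (c + ρ) s u (cutConst w (ρ / 5) *
          (∑ k ∈ Ico s u, stepEnergy ν ψ k + levelMass ν ψ (c - ρ) (c + ρ) s)) := by
      intro c s u hsu hu hk
      have he : c - ρ + 10 * (ρ / 5) = c + ρ := by ring
      have := ih (ρ := ρ / 5) (by positivity) (c - ρ) hsu hu (by rwa [he])
      rwa [he] at this
    obtain ⟨c, c', hcc, hcs⟩ : ∃ c c' : ℝ,
        (c = a + 3 * ρ ∧ c' = a + 7 * ρ ∨ c = a + 7 * ρ ∧ c' = a + 3 * ρ) ∧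
          levelCount ψ (c - ρ) (c + ρ) s ≤ w := by
      have := levelCount_add_le (ψ := ψ) (a := a) (b := a + 10 * ρ) (a₁ := a + 3 * ρ - ρ)
          (b₁ := a + 3 * ρ + ρ) (a₂ := a + 7 * ρ - ρ) (b₂ := a + 7 * ρ + ρ) (by linarith)
          (by linarith) (by linarith) (by linarith) (by linarith) s
      have := hc s le_rfl hst
      rcases le_or_gt (levelCount ψ (a + 3 * ρ - ρ) (a + 3 * ρ + ρ) s) w with h | h
      · exact ⟨_, _, Or.inl ⟨rfl, rfl⟩, h⟩
      · exact ⟨_, _, Or.inr ⟨rfl, rfl⟩, by omega⟩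
    refine (H.hasCut_step hρ hC ht ih' (t - s) s c c' (by omega) hcc hc hcs).mono
      le_rfl le_rfl ?_
    have hb : ∑ ω, ν s ω * bump c ρ (ψ s ω) ≤ 2 * levelMass ν ψ a (a + 10 * ρ) s := by
      rw [levelMass, mul_sum]
      refine sum_le_sum fun ω _ => ?_
      rw [mul_left_comm]
      refine mul_le_mul_of_nonneg_left ?_ (H.nonneg s ω)
      split_ifs with hω
      · linarith [bump_le c ρ (ψ s ω)]
      · rw [bump_eq_zero hρ, mul_zero]
        by_contra! hlt
        rw [abs_lt] at hlt
        exact hω (by rcases hcc with ⟨h, _⟩ | ⟨h, _⟩ <;> constructor <;> linarith)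
    have hE : 0 ≤ ∑ k ∈ Ico s t, stepEnergy ν ψ k :=
      sum_nonneg fun k _ => H.stepEnergy_nonneg k
    have hL := H.levelMass_nonneg a (a + 10 * ρ) s
    have hD : 0 ≤ 3 / (8 * ρ ^ 2) := by positivity
    have p1 := mul_le_mul_of_nonneg_left hb (show 0 ≤ cutConst w (ρ / 5) + 1 by linarith)
    have p2 := mul_nonneg hC hE
    have p3 := mul_nonneg hD hL
    rw [show cutConst (w + 1) ρ = 2 * (cutConst w (ρ / 5) + 1) + 3 / (8 * ρ ^ 2) from rfl]
    linarith

/-- The total energy is the drop in second moment. -/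
lemma sum_stepEnergy (H : IsReverseMartingale ν ψ m) :
    ∑ k ∈ range m, stepEnergy ν ψ k = ∑ ω, ν 0 ω * ψ 0 ω ^ 2 - ∑ ω, ν m ω * ψ m ω ^ 2 := by
  have h : ∀ k < m, stepEnergy ν ψ k
      = ∑ ω, ν k ω * ψ k ω ^ 2 - ∑ ω, ν (k + 1) ω * ψ (k + 1) ω ^ 2 := by
    intro k hk
    have h1 := H.shift k hk fun x => x ^ 2
    have h2 := H.mart k hk fun x => 2 * x
    rw [h1, ← add_zero (stepEnergy ν ψ k), ← h2, stepEnergy, ← sum_add_distrib,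
      ← sum_sub_distrib]
    exact sum_congr rfl fun ω _ => by ring
  rw [sum_congr rfl fun k hk => h k (mem_range.1 hk)]
  exact sum_range_sub' (fun k => ∑ ω, ν k ω * ψ k ω ^ 2) m

lemma sum_eq_sum (H : IsReverseMartingale ν ψ m) :
    ∑ ω, ν m ω * ψ m ω = ∑ ω, ν 0 ω * ψ 0 ω := by
  have h : ∀ k ≤ m, ∑ ω, ν k ω * ψ k ω = ∑ ω, ν 0 ω * ψ 0 ω := by
    intro k
    induction k with
    | zero => intro; rfl
    | succ k ih =>
      intro hk
      have h1 := H.shift k hk fun x => x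
      have h2 := H.mart k hk fun _ => 1
      rw [h1, ← ih (by omega), ← sub_eq_zero, ← sum_sub_distrib]
      rw [← neg_eq_zero, ← sum_neg_distrib, ← h2]
      exact sum_congr rfl fun ω _ => by ring
  exact h m le_rfl

end IsReverseMartingale

end ReverseMartingale

section TreeLaw

variable {ι Ω : Type*} [Fintype Ω]

/-- The functions obtained from `F` by applying the kernels `K (b 1) (b 0)`, `K (b 2) (b 1)`, …. -/
def transferSeq (K : ι → ι → Ω → Ω → ℝ) (b : ℕ → ι) (F : Ω → ℝ) : ℕ → Ω → ℝ
  | 0 => F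
  | k + 1 => fun y => ∑ x, K (b (k + 1)) (b k) y x * transferSeq K b F k x

lemma transferSeq_succ' (K : ι → ι → Ω → Ω → ℝ) (b : ℕ → ι) (F : Ω → ℝ) (k : ℕ) :
    transferSeq K b F (k + 1)
      = transferSeq K (fun j => b (j + 1)) (fun y => ∑ x, K (b 1) (b 0) y x * F x) k := by
  induction k with
  | zero => rfl
  | succ k ih => rw [transferSeq, ih]; rfl

/-- The function obtained from `F` by applying the kernels along a walk. -/
def transfer (K : ι → ι → Ω → Ω → ℝ) {T : SimpleGraph ι} {c d : ι} (w : T.Walk c d)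
    (F : Ω → ℝ) : Ω → ℝ :=
  transferSeq K w.getVert F w.length

lemma transfer_nil (K : ι → ι → Ω → Ω → ℝ) {T : SimpleGraph ι} (c : ι) (F : Ω → ℝ) :
    transfer K (SimpleGraph.Walk.nil : T.Walk c c) F = F := rfl

lemma transfer_cons (K : ι → ι → Ω → Ω → ℝ) {T : SimpleGraph ι} {c b d : ι} (h : T.Adj c b)
    (w : T.Walk b d) (F : Ω → ℝ) :
    transfer K (.cons h w) F = transfer K w fun y => ∑ x, K b c y x * F x := by
  rw [transfer, SimpleGraph.Walk.length_cons, transferSeq_succ', transfer]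
  simp

lemma transfer_concat (K : ι → ι → Ω → Ω → ℝ) {T : SimpleGraph ι} {c b d : ι} (w : T.Walk c b)
    (h : T.Adj b d) (F : Ω → ℝ) :
    transfer K (w.concat h) F = fun y => ∑ x, K d b y x * transfer K w F x := by
  induction w generalizing F with
  | nil => rw [SimpleGraph.Walk.concat_nil, transfer_cons, transfer_nil]; rfl
  | cons h' p ih => rw [SimpleGraph.Walk.concat_cons, transfer_cons, ih, transfer_cons]

variable [Fintype ι] [DecidableEq ι]

lemma sum_sum_update (M Φ : (ι → Ω) → ℝ) (l : ι) :
    ∑ x, (∑ z, M (Function.update x l z)) * Φ x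
      = ∑ x, M x * ∑ z, Φ (Function.update x l z) := by
  simp_rw [sum_mul, mul_sum]
  rw [← Fintype.sum_prod_type', ← Fintype.sum_prod_type']
  exact Fintype.sum_equiv
    ⟨fun p => (Function.update p.1 l p.2, p.1 l), fun p => (Function.update p.1 l p.2, p.1 l),
      fun p => by simp, fun p => by simp⟩ _ _ fun p => by simp

/-- `M` is a law on `ι → Ω` which on the coordinates in `A` is the Markov field on the graph `T`
with marginals `ν` and kernels `K`. -/
structure IsTreeLaw (T : SimpleGraph ι) (K : ι → ι → Ω → Ω → ℝ) (ν : ι → Ω → ℝ) (A : Finset ι)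
    (M : (ι → Ω) → ℝ) : Prop where
  nonneg : ∀ x, 0 ≤ M x
  marginal : ∀ c ∈ A, ∀ F : Ω → ℝ, ∑ x, M x * F (x c) = ∑ y, ν c y * F y
  path : ∀ c ∈ A, ∀ d ∈ A, ∃ w : T.Walk c d, w.IsPath ∧ (∀ v ∈ w.support, v ∈ A) ∧
    ∀ F H : Ω → ℝ, ∑ x, M x * (F (x c) * H (x d)) = ∑ y, ν d y * (transfer K w F y * H y)

variable {T : SimpleGraph ι} {K : ι → ι → Ω → Ω → ℝ} {ν : ι → Ω → ℝ}

lemma exists_isTreeLaw_singleton [DecidableEq Ω] (hν : ∀ a x, 0 ≤ ν a x) (b : ι) :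
    ∃ M, IsTreeLaw T K ν {b} M := by
  have hM : ∀ F : Ω → ℝ, ∑ x : ι → Ω, (∑ ω, if x = fun _ => ω then ν b ω else 0) * F (x b)
      = ∑ y, ν b y * F y := by
    intro F
    simp_rw [sum_mul]
    rw [sum_comm]
    refine sum_congr rfl fun ω _ => ?_
    simp [ite_mul]
  refine ⟨fun x => ∑ ω, if x = fun _ => ω then ν b ω else 0, fun x => ?_, ?_, ?_⟩
  · exact sum_nonneg fun ω _ => by split_ifs <;> simp [hν]
  · intro c hc F
    obtain rfl := mem_singleton.1 hc
    exact hM F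
  · intro c hc d hd
    obtain rfl := mem_singleton.1 hc
    obtain rfl := mem_singleton.1 hd
    exact ⟨.nil, by simp, by simp, fun F H => hM fun y => F y * H y⟩

lemma IsTreeLaw.exists_insert (hK : ∀ a b x y, 0 ≤ K a b x y) (hK1 : ∀ a b x, ∑ y, K a b x y = 1)
    (hbal : ∀ a b, T.Adj a b → ∀ x y, ν a x * K a b x y = ν b y * K b a y x)
    {A : Finset ι} {M : (ι → Ω) → ℝ} (hM : IsTreeLaw T K ν A M) {b l : ι} (hb : b ∈ A)
    (hl : l ∉ A) (hbl : T.Adj b l) : ∃ M', IsTreeLaw T K ν (insert l A) M' := by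
  let M' : (ι → Ω) → ℝ := fun x => (∑ z, M (Function.update x l z)) * K b l (x b) (x l)
  have hne : ∀ c ∈ A, c ≠ l := fun c hc h => hl (h ▸ hc)
  have main : ∀ Φ : (ι → Ω) → ℝ, ∑ x, M' x * Φ x
      = ∑ x, M x * ∑ z, K b l (x b) z * Φ (Function.update x l z) := by
    intro Φ
    have := sum_sum_update M (fun x => K b l (x b) (x l) * Φ x) l
    simp only [Function.update_self, Function.update_of_ne hbl.ne] at this
    rw [← this]
    exact sum_congr rfl fun x _ => by simp only [M']; ring
  have old : ∀ Φ : (ι → Ω) → ℝ, (∀ x z, Φ (Function.update x l z) = Φ x) →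
      ∑ x, M' x * Φ x = ∑ x, M x * Φ x := by
    intro Φ hΦ
    rw [main]
    refine sum_congr rfl fun x _ => ?_
    simp only [hΦ]
    rw [← sum_mul, hK1, one_mul]
  have bal : ∀ G H : Ω → ℝ, ∑ y, ν b y * (G y * ∑ z, K b l y z * H z)
      = ∑ z, ν l z * ((∑ y, K l b z y * G y) * H z) := by
    intro G H
    simp_rw [sum_mul, mul_sum]
    rw [sum_comm]
    refine sum_congr rfl fun z _ => sum_congr rfl fun y _ => ?_
    linear_combination G y * H z * hbal b l hbl y z
  have marg : ∀ F : Ω → ℝ, ∑ x, M' x * F (x l) = ∑ y, ν l y * F y := by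
    intro F
    rw [main]
    simp only [Function.update_self]
    rw [hM.marginal b hb fun y => ∑ z, K b l y z * F z]
    have := bal (fun _ => 1) F
    simpa [hK1] using this
  refine ⟨M', fun x => mul_nonneg (sum_nonneg fun _ _ => hM.nonneg _) (hK _ _ _ _), ?_, ?_⟩
  · intro c hc F
    rcases mem_insert.1 hc with rfl | hc
    · exact marg F
    · rw [old (fun x => F (x c)) fun x z => by simp [Function.update_of_ne (hne c hc)]]
      exact hM.marginal c hc F
  · intro c hc d hd
    rcases mem_insert.1 hc with rfl | hcA <;> rcases mem_insert.1 hd with rfl | hdA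
    · exact ⟨.nil, by simp, by simp, fun F H => marg fun y => F y * H y⟩
    · obtain ⟨w, hw, hwA, hwF⟩ := hM.path b hb d hdA
      refine ⟨.cons hbl.symm w, hw.cons fun h => hl (hwA _ h), ?_, fun F H => ?_⟩
      · intro v hv
        rw [SimpleGraph.Walk.support_cons, List.mem_cons] at hv
        rcases hv with rfl | hv
        · exact mem_insert_self _ _
        · exact mem_insert_of_mem (hwA v hv)
      · rw [main, transfer_cons, ← hwF]
        refine sum_congr rfl fun x _ => ?_
        simp only [Function.update_self, Function.update_of_ne (hne d hdA)]
        rw [sum_mul]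
        simp only [mul_assoc]
    · obtain ⟨w, hw, hwA, hwF⟩ := hM.path c hcA b hb
      refine ⟨w.concat hbl, hw.concat (fun h => hl (hwA _ h)) hbl, ?_, fun F H => ?_⟩
      · intro v hv
        rw [SimpleGraph.Walk.support_concat, List.mem_append, List.mem_singleton] at hv
        rcases hv with hv | rfl
        · exact mem_insert_of_mem (hwA v hv)
        · exact mem_insert_self _ _
      · rw [main, transfer_concat, ← bal, ← hwF F fun y => ∑ z, K b d y z * H z]
        refine sum_congr rfl fun x _ => ?_
        simp only [Function.update_self, Function.update_of_ne (hne c hcA)]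
        simp only [mul_sum]
        exact sum_congr rfl fun z _ => by ring
    · obtain ⟨w, hw, hwA, hwF⟩ := hM.path c hcA d hdA
      refine ⟨w, hw, fun v hv => mem_insert_of_mem (hwA v hv), fun F H => ?_⟩
      rw [old (fun x => F (x c) * H (x d)) fun x z => by
        simp [Function.update_of_ne (hne c hcA), Function.update_of_ne (hne d hdA)]]
      exact hwF F H

theorem exists_isTreeLaw [DecidableEq Ω] (hT : T.Connected) (hν : ∀ a x, 0 ≤ ν a x)
    (hK : ∀ a b x y, 0 ≤ K a b x y) (hK1 : ∀ a b x, ∑ y, K a b x y = 1)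
    (hbal : ∀ a b, T.Adj a b → ∀ x y, ν a x * K a b x y = ν b y * K b a y x) :
    ∃ M, IsTreeLaw T K ν univ M := by
  obtain ⟨b₀⟩ := hT.nonempty
  have key : ∀ k < Fintype.card ι, ∃ A : Finset ι, A.card = k + 1 ∧
      ∃ M, IsTreeLaw T K ν A M := by
    intro k
    induction k with
    | zero => exact fun _ => ⟨{b₀}, by simp, exists_isTreeLaw_singleton hν b₀⟩
    | succ k ih =>
      intro hk
      obtain ⟨A, hA, M, hM⟩ := ih (by omega)
      obtain ⟨a, ha⟩ : A.Nonempty := card_pos.1 (by omega)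
      obtain ⟨l, hl⟩ : ∃ l, l ∉ A := by
        by_contra! h
        rw [eq_univ_of_forall h, card_univ] at hA
        omega
      obtain ⟨p⟩ := hT.preconnected a l
      obtain ⟨d, -, hd1, hd2⟩ := p.exists_boundary_dart (A : Set ι) ha hl
      exact ⟨insert d.snd A, by rw [card_insert_of_notMem hd2, hA],
        hM.exists_insert hK hK1 hbal hd1 hd2 d.adj⟩
  obtain ⟨A, hA, h⟩ := key (Fintype.card ι - 1) (by
    have := Fintype.card_pos_iff.2 ⟨b₀⟩
    omega)
  have : A = univ := by
    rw [← card_eq_iff_eq_univ, hA]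
    have := Fintype.card_pos_iff.2 ⟨b₀⟩
    omega
  exact this ▸ h

end TreeLaw

section CondKernel

variable {V : Type*} [DecidableEq V] [Fintype V]

/-- The mass of the sets that agree with `x` on `S`. -/
def fiberMass (ν : Finset V → ℝ) (S x : Finset V) : ℝ :=
  ∑ z, if z ∩ S = x ∩ S then ν z else 0

/-- The law `ν` conditioned on agreeing with `x` on `S`, or `ν` itself if that has no mass. -/
noncomputable def condKernel (ν : Finset V → ℝ) (S x z : Finset V) : ℝ :=
  if fiberMass ν S x = 0 then ν z else if z ∩ S = x ∩ S then ν z / fiberMass ν S x else 0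

/-- The two weights have the same marginal on `S`. -/
def AgreeOn (ν ν' : Finset V → ℝ) (S : Finset V) : Prop :=
  ∀ G : Finset V → ℝ, ∑ x, ν x * G (x ∩ S) = ∑ x, ν' x * G (x ∩ S)

lemma AgreeOn.symm {ν ν' : Finset V → ℝ} {S : Finset V} (h : AgreeOn ν ν' S) :
    AgreeOn ν' ν S := fun G => (h G).symm

lemma AgreeOn.trans {ν ν' ν'' : Finset V → ℝ} {S : Finset V} (h : AgreeOn ν ν' S)
    (h' : AgreeOn ν' ν'' S) : AgreeOn ν ν'' S := fun G => (h G).trans (h' G)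

lemma AgreeOn.mono {ν ν' : Finset V → ℝ} {S S' : Finset V} (h : AgreeOn ν ν' S') (hS : S ⊆ S') :
    AgreeOn ν ν' S := fun G => by
  simpa only [inter_assoc, inter_eq_right.2 hS] using h fun x => G (x ∩ S)

lemma AgreeOn.sum_eq {ν ν' : Finset V → ℝ} {S : Finset V} (h : AgreeOn ν ν' S)
    {G : Finset V → ℝ} (hG : ∀ x, G (x ∩ S) = G x) : ∑ x, ν x * G x = ∑ x, ν' x * G x := by
  simpa only [hG] using h G

variable {ν ν' : Finset V → ℝ} {S : Finset V}

lemma AgreeOn.fiberMass_eq (h : AgreeOn ν ν' S) (x : Finset V) :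
    fiberMass ν S x = fiberMass ν' S x := by
  have := h fun z => if z = x ∩ S then 1 else 0
  simpa [fiberMass] using this

lemma fiberMass_congr {x y : Finset V} (h : x ∩ S = y ∩ S) : fiberMass ν S x = fiberMass ν S y := by
  simp only [fiberMass, h]

lemma fiberMass_nonneg (hν : ∀ x, 0 ≤ ν x) (x : Finset V) : 0 ≤ fiberMass ν S x :=
  sum_nonneg fun z _ => by split_ifs <;> simp [hν]

lemma eq_zero_of_fiberMass_eq_zero (hν : ∀ x, 0 ≤ ν x) {x : Finset V} (h : fiberMass ν S x = 0) :
    ν x = 0 := by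
  have := (sum_eq_zero_iff_of_nonneg fun z _ => by split_ifs <;> simp [hν]).1 h x (mem_univ x)
  simpa using this

lemma condKernel_nonneg (hν : ∀ x, 0 ≤ ν x) (x z : Finset V) : 0 ≤ condKernel ν S x z := by
  unfold condKernel
  have := fiberMass_nonneg (S := S) hν x
  have := hν z
  split_ifs <;> positivity

lemma sum_condKernel (h1 : ∑ x, ν x = 1) (x : Finset V) : ∑ z, condKernel ν S x z = 1 := by
  unfold condKernel
  split_ifs with h
  · exact h1
  · rw [← div_self h]
    nth_rw 2 [fiberMass]
    rw [sum_div]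
    exact sum_congr rfl fun z _ => by split_ifs <;> simp

lemma condKernel_congr {x y : Finset V} (h : x ∩ S = y ∩ S) (z : Finset V) :
    condKernel ν S x z = condKernel ν S y z := by
  simp only [condKernel, h, fiberMass_congr h]

lemma condKernel_inter (x z : Finset V) : condKernel ν S (x ∩ S) z = condKernel ν S x z :=
  condKernel_congr (by simp) z

/-- Detailed balance for conditioning on a common marginal. -/
lemma mul_condKernel (hν : ∀ x, 0 ≤ ν x) (hν' : ∀ x, 0 ≤ ν' x) (h : AgreeOn ν ν' S)
    (y z : Finset V) : ν' y * condKernel ν S y z = ν z * condKernel ν' S z y := by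
  have hz : fiberMass ν S z = 0 → ν z * condKernel ν' S z y = 0 := fun h0 => by
    rw [eq_zero_of_fiberMass_eq_zero hν h0, zero_mul]
  by_cases hzy : z ∩ S = y ∩ S
  · have hf : fiberMass ν S z = fiberMass ν S y := fiberMass_congr hzy
    by_cases h1 : fiberMass ν S y = 0
    · rw [hz (hf.trans h1), eq_zero_of_fiberMass_eq_zero hν' (h.fiberMass_eq y ▸ h1), zero_mul]
    · rw [condKernel, condKernel, ← h.fiberMass_eq z, hf, if_neg h1, if_neg h1, if_pos hzy,
        if_pos hzy.symm]
      ring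
  · have hl : ν' y * condKernel ν S y z = 0 := by
      by_cases h1 : fiberMass ν S y = 0
      · rw [eq_zero_of_fiberMass_eq_zero hν' (h.fiberMass_eq y ▸ h1), zero_mul]
      · rw [condKernel, if_neg h1, if_neg hzy, mul_zero]
    rw [hl]
    by_cases h1 : fiberMass ν S z = 0
    · exact (hz h1).symm
    · rw [condKernel, ← h.fiberMass_eq z, if_neg h1, if_neg (Ne.symm hzy), mul_zero]

/-- The kernel `condKernel ν S` computes conditional expectations given the trace on `S`. -/
lemma sum_condKernel_mul (hν : ∀ x, 0 ≤ ν x) (h1 : ∑ x, ν x = 1) (F : Finset V → ℝ)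
    {G : Finset V → ℝ} (hG : ∀ x, G (x ∩ S) = G x) :
    ∑ y, ν y * ((∑ z, condKernel ν S y z * F z) * G y) = ∑ z, ν z * (F z * G z) := by
  have h : ∀ y z, ν y * condKernel ν S y z * G y = ν z * condKernel ν S z y * G z := by
    intro y z
    by_cases hzy : z ∩ S = y ∩ S
    · rw [mul_condKernel hν hν (fun _ => rfl), ← hG y, ← hzy, hG z]
    · have h0 : ∀ y z : Finset V, z ∩ S ≠ y ∩ S → ν y * condKernel ν S y z = 0 := by
        intro y z hzy
        by_cases h1 : fiberMass ν S y = 0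
        · rw [eq_zero_of_fiberMass_eq_zero hν h1, zero_mul]
        · rw [condKernel, if_neg h1, if_neg hzy, mul_zero]
      rw [h0 y z hzy, h0 z y (Ne.symm hzy), zero_mul, zero_mul]
  simp_rw [sum_mul, mul_sum]
  rw [sum_comm]
  refine sum_congr rfl fun z _ => ?_
  calc ∑ y, ν y * (condKernel ν S y z * F z * G y)
      = ∑ y, condKernel ν S z y * (ν z * (F z * G z)) :=
        sum_congr rfl fun y _ => by linear_combination F z * h y z
    _ = ν z * (F z * G z) := by rw [← sum_mul, sum_condKernel h1, one_mul]

end CondKernel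

section SheraliAdamsLaw

variable {n : ℕ}

/-- The local distribution of the true set on `B` given by a Sherali–Adams vector. -/
noncomputable def saLaw (y : Finset (Fin n) → ℝ) (B J : Finset (Fin n)) : ℝ :=
  if J ⊆ B then saIJ y (B \ J) J / y ∅ else 0

lemma saIJ_insert_add (y : Finset (Fin n) → ℝ) {I J : Finset (Fin n)} {v : Fin n} (hI : v ∉ I) :
    saIJ y (insert v I) J + saIJ y I (insert v J) = saIJ y I J := by
  unfold saIJ
  rw [sum_powerset_insert hI, add_assoc, ← sum_add_distrib, add_eq_left]
  refine sum_eq_zero fun I' hI' => ?_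
  have : v ∉ I' := fun h => hI (mem_powerset.1 hI' h)
  rw [card_insert_of_notMem this, insert_union, union_insert, pow_succ]
  ring

lemma sum_saLaw_mul (y : Finset (Fin n) → ℝ) (B : Finset (Fin n)) (F : Finset (Fin n) → ℝ) :
    ∑ J, saLaw y B J * F J = ∑ J ∈ B.powerset, saIJ y (B \ J) J / y ∅ * F J := by
  rw [← sum_subset (subset_univ B.powerset)]
  · refine sum_congr rfl fun J hJ => ?_
    rw [saLaw, if_pos (mem_powerset.1 hJ)]
  · intro J _ hJ
    rw [saLaw, if_neg (mt mem_powerset.2 hJ), zero_mul]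

lemma agreeOn_saLaw_insert (y : Finset (Fin n) → ℝ) {B : Finset (Fin n)} {v : Fin n}
    (hv : v ∉ B) : AgreeOn (saLaw y (insert v B)) (saLaw y B) B := by
  intro G
  rw [sum_saLaw_mul, sum_saLaw_mul, sum_powerset_insert hv, ← sum_add_distrib]
  refine sum_congr rfl fun J hJ => ?_
  rw [mem_powerset] at hJ
  have hvJ : v ∉ J := fun h => hv (hJ h)
  rw [insert_inter_of_notMem hv, insert_sdiff_of_notMem _ hvJ, insert_sdiff_insert,
    sdiff_insert_of_notMem hv, ← saIJ_insert_add y (I := B \ J) (J := J) (v := v) (by simp [hv])]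
  ring

lemma agreeOn_saLaw_of_subset (y : Finset (Fin n) → ℝ) {B B' : Finset (Fin n)} (h : B ⊆ B') :
    AgreeOn (saLaw y B') (saLaw y B) B := by
  have key : ∀ D : Finset (Fin n), AgreeOn (saLaw y (B ∪ D)) (saLaw y B) B := by
    intro D
    induction D using Finset.induction_on with
    | empty => rw [union_empty]; exact fun _ => rfl
    | insert v D _ ih =>
      rw [union_insert]
      by_cases hv : v ∈ B ∪ D
      · rwa [insert_eq_of_mem hv]
      · exact ((agreeOn_saLaw_insert y hv).mono subset_union_left).trans ih
  have := key B'
  rwa [union_eq_right.2 h] at this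

lemma agreeOn_saLaw (y : Finset (Fin n) → ℝ) {S B B' : Finset (Fin n)} (h : S ⊆ B)
    (h' : S ⊆ B') : AgreeOn (saLaw y B) (saLaw y B') S :=
  (agreeOn_saLaw_of_subset y h).trans (agreeOn_saLaw_of_subset y h').symm

lemma saLaw_nonneg {y : Finset (Fin n) → ℝ} {t : ℕ} (hy : memSA t y) (h0 : 0 < y ∅)
    {B : Finset (Fin n)} (hB : B.card ≤ t) (J : Finset (Fin n)) : 0 ≤ saLaw y B J := by
  unfold saLaw
  split_ifs with h
  · exact div_nonneg (hy _ _ (by rwa [sdiff_union_of_subset h])) h0.le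
  · exact le_rfl

lemma sum_saLaw {y : Finset (Fin n) → ℝ} (h0 : 0 < y ∅) (B : Finset (Fin n)) :
    ∑ J, saLaw y B J = 1 := by
  have h := agreeOn_saLaw_of_subset y (empty_subset B) fun _ => 1
  rw [sum_saLaw_mul y ∅] at h
  simpa [saIJ, h0.ne'] using h

lemma sum_saLaw_pair (y : Finset (Fin n) → ℝ) {B : Finset (Fin n)} {i j : Fin n} (hij : i ≠ j)
    (hi : i ∈ B) (hj : j ∈ B) :
    ∑ J, saLaw y B J * (if i ∈ J ∧ j ∉ J then 1 else 0) = saIJ y {j} {i} / y ∅ := by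
  have hsub : {i, j} ⊆ B := by
    intro x hx
    rcases mem_insert.1 hx with rfl | hx
    · exact hi
    · exact mem_singleton.1 hx ▸ hj
  rw [(agreeOn_saLaw_of_subset y hsub).sum_eq fun x => by simp, sum_saLaw_mul,
    sum_eq_single {i}]
  · have : ({i, j} : Finset (Fin n)) \ {i} = {j} := by
      ext x
      simp only [mem_sdiff, mem_insert, mem_singleton]
      constructor
      · tauto
      · rintro rfl
        exact ⟨Or.inr rfl, hij.symm⟩
    simp [this, hij.symm]
  · intro J hJ hne
    rw [if_neg, mul_zero]
    rintro ⟨h1, h2⟩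
    refine hne (Finset.ext fun x => ⟨fun hx => ?_, fun hx => mem_singleton.1 hx ▸ h1⟩)
    have := mem_powerset.1 hJ hx
    rw [mem_insert, mem_singleton] at this
    rcases this with rfl | rfl
    · simp
    · exact absurd hx h2
  · simp

/-- Along a sequence of bags, the probability that `i` is true and `j` is false under the
Sherali–Adams vector is at most a constant times the probability that `i` and `j` differ in the
Markov chain on the bags; here `ψ k` is the conditional probability that `i` is true. -/
theorem pair_le_chain {r : ℕ} {y : Finset (Fin n) → ℝ} (hy : memSA (r + 3) y) (h0 : 0 < y ∅)
    {B : ℕ → Finset (Fin n)} (hB : ∀ k, (B k).card ≤ r + 1) {i j : Fin n} (hij : i ≠ j) {m : ℕ}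
    (hi : i ∈ B 0) (hj : j ∈ B m) {ψ : ℕ → Finset (Fin n) → ℝ}
    (hψ0 : ψ 0 = fun x => if i ∈ x then 1 else 0)
    (hψ : ∀ k, ψ (k + 1)
      = fun x => ∑ z, condKernel (saLaw y (B k)) (B (k + 1) ∩ B k) x z * ψ k z) :
    saIJ y {j} {i} / y ∅ ≤ (cutConst (2 ^ (r + 1)) (1 / 20) + 4) *
      (∑ x, saLaw y (B m) x * (ψ m x * if j ∈ x then 0 else 1)
        + ∑ x, saLaw y (B m) x * ((1 - ψ m x) * if j ∈ x then 1 else 0)) := by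
  have hν : ∀ k x, 0 ≤ saLaw y (B k) x := fun k =>
    saLaw_nonneg hy h0 ((hB k).trans (by omega))
  have hν' : ∀ k x, 0 ≤ saLaw y (B k ∪ {i, j}) x := fun k => by
    refine saLaw_nonneg hy h0 ((card_union_le _ _).trans ?_)
    have := hB k
    have := card_le_two (a := i) (b := j)
    omega
  have hinv : ∀ k x, ψ (k + 1) (x ∩ (B (k + 1) ∩ B k)) = ψ (k + 1) x := fun k x => by
    simp only [hψ, condKernel_inter]
  have hinvB : ∀ k x, ψ k (x ∩ B k) = ψ k x := by
    rintro (_ | k) x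
    · simp [hψ0, hi]
    · rw [← hinv, inter_assoc, inter_eq_right.2 inter_subset_left, hinv]
  have hinvB' : ∀ k x, ψ (k + 1) (x ∩ B k) = ψ (k + 1) x := fun k x => by
    rw [← hinv, inter_assoc, inter_eq_right.2 inter_subset_right, hinv]
  have hH : IsReverseMartingale (fun k => saLaw y (B k)) ψ m := by
    refine ⟨hν, fun k _ g => ?_, fun k _ g => ?_⟩
    · exact (agreeOn_saLaw y inter_subset_left inter_subset_right).sum_eq fun x => by
        rw [hinv]
    · have := sum_condKernel_mul (hν k) (sum_saLaw h0 (B k)) (ψ k)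
        (G := fun x => g (ψ (k + 1) x)) (S := B (k + 1) ∩ B k) fun x => by rw [hinv]
      rw [← sub_eq_zero, ← sum_sub_distrib] at this
      rw [← neg_eq_zero, ← sum_neg_distrib, ← this]
      refine sum_congr rfl fun x _ => ?_
      rw [show ∑ z, condKernel (saLaw y (B k)) (B (k + 1) ∩ B k) x z * ψ k z = ψ (k + 1) x from
        (congrFun (hψ k) x).symm]
      ring
  have hψ01 : ∀ k x, 0 ≤ ψ k x ∧ ψ k x ≤ 1 := by
    intro k
    induction k with
    | zero => intro x; rw [hψ0]; dsimp only; split_ifs <;> norm_num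
    | succ k ih =>
      intro x
      have hK := condKernel_nonneg (S := B (k + 1) ∩ B k) (hν k) x
      rw [hψ, ← sum_condKernel (S := B (k + 1) ∩ B k) (sum_saLaw h0 (B k)) x]
      exact ⟨sum_nonneg fun z _ => mul_nonneg (hK z) (ih z).1,
        sum_le_sum fun z _ => mul_le_of_le_one_right (hK z) (ih z).2⟩
  have hcount : ∀ k, levelCount ψ (1 / 4) (1 / 4 + 10 * (1 / 20)) k ≤ 2 ^ (r + 1) := by
    intro k
    calc levelCount ψ (1 / 4) (1 / 4 + 10 * (1 / 20)) k
        ≤ (univ.image (ψ k)).card := card_filter_le _ _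
      _ ≤ ((B k).powerset.image (ψ k)).card := by
          refine card_le_card fun v hv => ?_
          obtain ⟨x, -, rfl⟩ := mem_image.1 hv
          exact mem_image.2 ⟨x ∩ B k, mem_powerset.2 inter_subset_right, hinvB k x⟩
      _ ≤ (B k).powerset.card := card_image_le
      _ ≤ 2 ^ (r + 1) := by
          rw [card_powerset]
          exact Nat.pow_le_pow_right (by norm_num) (hB k)
  have hmass0 : levelMass (fun k => saLaw y (B k)) ψ (1 / 4) (1 / 4 + 10 * (1 / 20)) 0 = 0 := by
    refine sum_eq_zero fun x _ => ?_
    rw [if_neg, mul_zero]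
    rw [hψ0]
    dsimp only
    split_ifs <;> norm_num
  obtain ⟨θ, hθ, hcut⟩ := hH.hasCut (2 ^ (r + 1)) (ρ := 1 / 20) (by norm_num) (1 / 4)
    (Nat.zero_le m) le_rfl fun k _ _ => hcount k
  rw [hmass0, add_zero] at hcut
  set C := cutConst (2 ^ (r + 1)) (1 / 20)
  have hC : 0 ≤ C := cutConst_nonneg _ _
  rw [← range_eq_Ico, hH.sum_stepEnergy] at hcut
  have hdrop : ∑ x, saLaw y (B 0) x * ψ 0 x ^ 2 - ∑ x, saLaw y (B m) x * ψ m x ^ 2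
      ≤ ∑ x, saLaw y (B m) x * (ψ m x * if j ∈ x then 0 else 1)
        + ∑ x, saLaw y (B m) x * ((1 - ψ m x) * if j ∈ x then 1 else 0) := by
    have h1 : ∑ x, saLaw y (B 0) x * ψ 0 x ^ 2 = ∑ x, saLaw y (B 0) x * ψ 0 x :=
      sum_congr rfl fun x _ => by rw [hψ0]; dsimp only; split_ifs <;> norm_num
    rw [h1, ← hH.sum_eq_sum, ← sum_sub_distrib, ← sum_add_distrib]
    refine sum_le_sum fun x _ => ?_
    rw [← mul_sub, ← mul_add]
    refine mul_le_mul_of_nonneg_left ?_ (hν m x)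
    obtain ⟨ha, hb⟩ := hψ01 m x
    split_ifs <;> nlinarith
  have hflow : ∀ k ≤ m, ∑ x, saLaw y (B k ∪ {i, j}) x *
      (if (i ∈ x ∧ j ∉ x) ∧ ψ k x ≤ θ k then 1 else 0)
        ≤ ∑ l ∈ range k, crossMass (fun k => saLaw y (B k)) ψ θ l := by
    intro k
    induction k with
    | zero =>
      intro _
      refine le_of_eq (sum_eq_zero fun x _ => ?_)
      rw [if_neg, mul_zero]
      rintro ⟨⟨h1, _⟩, h2⟩
      rw [hψ0] at h2
      have := hθ 0 le_rfl (Nat.zero_le m)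
      simp only [h1, if_true] at h2
      linarith
    | succ k ih =>
      intro hk
      have hS : ∀ x, ψ (k + 1) (x ∩ (B (k + 1) ∩ B k ∪ {i, j})) = ψ (k + 1) x := fun x => by
        rw [← hinv, inter_assoc, inter_eq_right.2 subset_union_left, hinv]
      have e1 : ∑ x, saLaw y (B (k + 1) ∪ {i, j}) x *
          (if (i ∈ x ∧ j ∉ x) ∧ ψ (k + 1) x ≤ θ (k + 1) then 1 else 0)
          = ∑ x, saLaw y (B k ∪ {i, j}) x *
            (if (i ∈ x ∧ j ∉ x) ∧ ψ (k + 1) x ≤ θ (k + 1) then 1 else 0) :=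
        (agreeOn_saLaw y (S := B (k + 1) ∩ B k ∪ {i, j})
          (union_subset_union_left inter_subset_left)
          (union_subset_union_left inter_subset_right)).sum_eq fun x => by
            rw [hS]
            simp
      have e2 : crossMass (fun k => saLaw y (B k)) ψ θ k
          = ∑ x, saLaw y (B k ∪ {i, j}) x *
            if θ k < ψ k x ∧ ψ (k + 1) x ≤ θ (k + 1) then 1 else 0 :=
        (agreeOn_saLaw y Subset.rfl subset_union_left).sum_eq fun x => by rw [hinvB, hinvB']
      rw [e1, sum_range_succ, e2]
      refine le_trans ?_ (add_le_add_left (ih (by omega)) _)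
      rw [← sum_add_distrib]
      refine sum_le_sum fun x _ => ?_
      rw [← mul_add]
      refine mul_le_mul_of_nonneg_left ?_ (hν' k x)
      by_cases hx : ψ k x ≤ θ k
      · split_ifs <;> first | (norm_num; done) | tauto
      · have hx' := not_le.1 hx
        split_ifs <;> first | (norm_num; done) | tauto
  have hend : ∑ x, saLaw y (B m ∪ {i, j}) x * (if j ∉ x ∧ θ m < ψ m x then 1 else 0)
      ≤ 4 * ∑ x, saLaw y (B m) x * (ψ m x * if j ∈ x then 0 else 1) := by
    have : ∑ x, saLaw y (B m ∪ {i, j}) x * (if j ∉ x ∧ θ m < ψ m x then (1 : ℝ) else 0)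
        = ∑ x, saLaw y (B m) x * (if j ∉ x ∧ θ m < ψ m x then 1 else 0) :=
      (agreeOn_saLaw y subset_union_left Subset.rfl).sum_eq fun x => by
        rw [hinvB]
        simp [hj]
    rw [this, mul_sum]
    refine sum_le_sum fun x _ => ?_
    rw [mul_left_comm]
    refine mul_le_mul_of_nonneg_left ?_ (hν m x)
    have h1 := hθ m (Nat.zero_le m) le_rfl
    have h2 := hψ01 m x
    by_cases hjx : j ∈ x
    · simp [hjx]
    · simp only [hjx, not_false_eq_true, true_and, if_false]
      split_ifs <;> linarith
  have hsplit : saIJ y {j} {i} / y ∅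
      ≤ ∑ x, saLaw y (B m ∪ {i, j}) x * (if (i ∈ x ∧ j ∉ x) ∧ ψ m x ≤ θ m then 1 else 0)
        + ∑ x, saLaw y (B m ∪ {i, j}) x * (if j ∉ x ∧ θ m < ψ m x then 1 else 0) := by
    rw [← sum_saLaw_pair y hij (B := B m ∪ {i, j}) (by simp) (by simp), ← sum_add_distrib]
    refine sum_le_sum fun x _ => ?_
    rw [← mul_add]
    refine mul_le_mul_of_nonneg_left ?_ (hν' m x)
    by_cases hx : ψ m x ≤ θ m
    · split_ifs <;> first | (norm_num; done) | tauto
    · have hx' := not_le.1 hx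
      split_ifs <;> first | (norm_num; done) | tauto
  have hP2 : 0 ≤ ∑ x, saLaw y (B m) x * ((1 - ψ m x) * if j ∈ x then 1 else 0) :=
    sum_nonneg fun x _ => mul_nonneg (hν m x) (mul_nonneg (by linarith [(hψ01 m x).2])
      (by split_ifs <;> norm_num))
  have hm := hflow m le_rfl
  have := mul_le_mul_of_nonneg_left hdrop hC
  linarith

end SheraliAdamsLaw

section TreeDecompositionLaw

variable {n : ℕ} {ι : Type*}

/-- The kernel that resamples the bag `B b` given the assignment of the bag `B a`. -/
noncomputable def bagKernel (y : Finset (Fin n) → ℝ) (B : ι → Finset (Fin n)) (a b : ι) :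
    Finset (Fin n) → Finset (Fin n) → ℝ :=
  condKernel (saLaw y (B b)) (B a ∩ B b)

variable [Fintype ι] [DecidableEq ι] {T : SimpleGraph ι} {B : ι → Finset (Fin n)}
  {y : Finset (Fin n) → ℝ}

lemma exists_isTreeLaw_saLaw {t : ℕ} (hT : T.Connected) (hy : memSA t y) (h0 : 0 < y ∅)
    (hB : ∀ b, (B b).card ≤ t) :
    ∃ M, IsTreeLaw T (bagKernel y B) (fun b => saLaw y (B b)) univ M := by
  have hν : ∀ b x, 0 ≤ saLaw y (B b) x := fun b => saLaw_nonneg hy h0 (hB b)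
  refine exists_isTreeLaw hT hν (fun a b x z => condKernel_nonneg (hν b) x z)
    (fun a b x => sum_condKernel (sum_saLaw h0 (B b)) x) fun a b _ x z => ?_
  rw [bagKernel, bagKernel, inter_comm (B b)]
  exact mul_condKernel (hν b) (hν a) (agreeOn_saLaw y inter_subset_right inter_subset_left) x z

variable {M : (ι → Finset (Fin n)) → ℝ}

lemma IsTreeLaw.mem_of_adj {t : ℕ}
    (hM : IsTreeLaw T (bagKernel y B) (fun b => saLaw y (B b)) univ M)
    (hT : T.IsAcyclic) (hy : memSA t y) (h0 : 0 < y ∅) (hB : ∀ b, (B b).card ≤ t) {a b : ι}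
    (hab : T.Adj a b) {v : Fin n} (ha : v ∈ B a) (hb : v ∈ B b) {x : ι → Finset (Fin n)}
    (hx : M x ≠ 0) (hv : v ∈ x a) : v ∈ x b := by
  obtain ⟨w, hw, -, hF⟩ := hM.path a (mem_univ a) b (mem_univ b)
  have hw' : w = .cons hab .nil := congrArg Subtype.val
    ((hT.subsingleton_path a b).elim ⟨w, hw⟩ ⟨.cons hab .nil, by simp [hab.ne]⟩)
  have h := hF (fun J => if v ∈ J then 1 else 0) fun J => if v ∈ J then 0 else 1
  rw [hw', transfer_cons, transfer_nil, bagKernel,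
    (agreeOn_saLaw y (S := B b ∩ B a) inter_subset_left inter_subset_right).sum_eq fun z => by
      simp only [condKernel_inter]
      simp [ha, hb],
    sum_condKernel_mul (saLaw_nonneg hy h0 (hB a)) (sum_saLaw h0 (B a)) _ fun z => by
      simp [ha, hb]] at h
  rw [sum_eq_zero (s := univ) (f := fun z => saLaw y (B a) z * _) fun z _ => by
      split_ifs <;> simp,
    sum_eq_zero_iff_of_nonneg fun z _ => mul_nonneg (hM.nonneg z) (by split_ifs <;> simp)] at h
  by_contra hvb
  exact hx (by simpa [hv, hvb] using h x (mem_univ x))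

lemma IsTreeLaw.mem_iff {t : ℕ}
    (hM : IsTreeLaw T (bagKernel y B) (fun b => saLaw y (B b)) univ M)
    (hT : T.IsAcyclic) (hy : memSA t y) (h0 : 0 < y ∅) (hB : ∀ b, (B b).card ≤ t) {v : Fin n}
    (hv : (T.induce {b | v ∈ B b}).Connected) {a b : ι} (ha : v ∈ B a) (hb : v ∈ B b)
    {x : ι → Finset (Fin n)} (hx : M x ≠ 0) : v ∈ x a ↔ v ∈ x b := by
  obtain ⟨p⟩ := hv.preconnected ⟨a, ha⟩ ⟨b, hb⟩
  have key : ∀ {c d : {b | v ∈ B b}}, (T.induce {b | v ∈ B b}).Walk c d →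
      (v ∈ x c ↔ v ∈ x d) := by
    intro c d p
    induction p with
    | nil => rfl
    | @cons c e d h p ih =>
      have h' : T.Adj c e := h
      exact Iff.trans ⟨hM.mem_of_adj hT hy h0 hB h' c.2 e.2 hx,
        hM.mem_of_adj hT hy h0 hB h'.symm e.2 c.2 hx⟩ ih
  exact key p

/-- In the Markov field on a tree of bags, two vertices differ with probability at least a constant
times the probability that the first is true and the second false under the Sherali–Adams vector. -/
lemma IsTreeLaw.pair_le {r : ℕ}
    (hM : IsTreeLaw T (bagKernel y B) (fun b => saLaw y (B b)) univ M)
    (hy : memSA (r + 3) y) (h0 : 0 < y ∅) (hB : ∀ b, (B b).card ≤ r + 1) {i j : Fin n}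
    (hij : i ≠ j) {a b : ι} (hi : i ∈ B a) (hj : j ∈ B b) :
    saIJ y {j} {i} / y ∅ ≤ (cutConst (2 ^ (r + 1)) (1 / 20) + 4) *
      ∑ x, M x * if (i ∈ x a ↔ j ∈ x b) then 0 else 1 := by
  obtain ⟨w, -, -, hF⟩ := hM.path a (mem_univ a) b (mem_univ b)
  have h := pair_le_chain hy h0 (B := fun k => B (w.getVert k)) (fun k => hB _) hij
    (m := w.length) (by simpa using hi) (by simpa using hj)
    (ψ := transferSeq (bagKernel y B) w.getVert fun J => if i ∈ J then 1 else 0) rfl fun _ => rfl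
  refine h.trans_eq ?_
  congr 1
  have h1 := hF (fun J => if i ∈ J then 1 else 0) fun J => if j ∈ J then 0 else 1
  have h2 := hF (fun J => if i ∈ J then 1 else 0) fun J => if j ∈ J then 1 else 0
  have h3 := hM.marginal b (mem_univ b) fun J => if j ∈ J then 1 else 0
  simp only [SimpleGraph.Walk.getVert_length, sub_mul, one_mul, mul_sub, sum_sub_distrib]
  rw [transfer] at h1 h2
  rw [← h1, ← h2, ← h3, ← sum_sub_distrib, ← sum_add_distrib]
  refine sum_congr rfl fun x _ => ?_
  by_cases h1 : i ∈ x a <;> by_cases h2 : j ∈ x b <;> simp [h1, h2]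

end TreeDecompositionLaw

lemma sum_filter_pushforward {α β : Type*} [Fintype α] [Fintype β] [DecidableEq β] (M : α → ℝ)
    (φ : α → β) (P : β → Prop) [DecidablePred P] :
    ∑ f ∈ univ.filter P, ∑ x, (if f = φ x then M x else 0)
      = ∑ x, M x * if P (φ x) then 1 else 0 := by
  rw [sum_comm]
  refine sum_congr rfl fun x _ => ?_
  rw [sum_ite_eq']
  simp

open scoped Classical in
/-- Lemma 3 of the paper, combined with Lemma 2: for every `r > 0` there is a
constant `c_r > 0` such that for every graph `G` on `n` vertices with a tree decomposition of
width at most `r` and every symmetric `y ∈ SA_{r+3}(n)` with `y_∅ > 0`, there is a probability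
distribution `μ` over assignments `f : V → {0,1}` such that every edge `(i,j)` is cut with
probability exactly `ỹ_{i≠j}` and every pair of vertices `i ≠ j` is cut with probability at
least `c_r · ỹ_{i≠j}`. -/
theorem stmt1 (r : ℕ) (hr : 0 < r) :
    ∃ c : ℝ, 0 < c ∧
      ∀ (n : ℕ) (G : SimpleGraph (Fin n)) (td : TreeDecomp G) (y : Finset (Fin n) → ℝ),
        1 ≤ n →
        (∀ i, (td.bags i).card ≤ r + 1) →
        memSA (r + 3) y → 0 < y ∅ →
        (∀ I J : Finset (Fin n), (I ∪ J).card ≤ r + 3 → saIJ y I J = saIJ y J I) →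
        ∃ μ : (Fin n → Bool) → ℝ,
          (∀ f, 0 ≤ μ f) ∧ (∑ f, μ f = 1) ∧
          (∀ i j : Fin n, G.Adj i j →
            (∑ f ∈ Finset.univ.filter (fun f : Fin n → Bool => f i ≠ f j), μ f)
              = yNeq y i j / y ∅) ∧
          (∀ i j : Fin n, i ≠ j →
            c * (yNeq y i j / y ∅) ≤
              ∑ f ∈ Finset.univ.filter (fun f : Fin n → Bool => f i ≠ f j), μ f) := by
  classical
  have hC := cutConst_nonneg (2 ^ (r + 1)) (1 / 20)
  set C := cutConst (2 ^ (r + 1)) (1 / 20) with hCdef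
  refine ⟨1 / (2 * (C + 4)), by positivity, ?_⟩
  intro n G td y _ hcard hy h0 _
  have := td.fintype_ι
  have hcard' : ∀ b, (td.bags b).card ≤ r + 3 := fun b => (hcard b).trans (by omega)
  obtain ⟨M, hM⟩ := exists_isTreeLaw_saLaw td.connected hy h0 hcard'
  choose β hβ using td.covers_vertices
  let φ : (td.ι → Finset (Fin n)) → Fin n → Bool := fun x v => decide (v ∈ x (β v))
  have hdiff : ∀ i j : Fin n,
      ∑ f ∈ univ.filter (fun f : Fin n → Bool => f i ≠ f j), ∑ x, (if f = φ x then M x else 0)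
        = ∑ x, M x * if (i ∈ x (β i) ↔ j ∈ x (β j)) then 0 else 1 := by
    intro i j
    rw [sum_filter_pushforward]
    refine sum_congr rfl fun x _ => ?_
    by_cases h1 : i ∈ x (β i) <;> by_cases h2 : j ∈ x (β j) <;> simp [φ, h1, h2]
  refine ⟨fun f => ∑ x, if f = φ x then M x else 0, fun f => ?_, ?_, fun i j hadj => ?_,
    fun i j hij => ?_⟩
  · exact sum_nonneg fun x _ => by split_ifs <;> simp [hM.nonneg]
  · have h1 := sum_filter_pushforward M φ fun _ => True
    obtain ⟨b⟩ := td.connected.nonempty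
    have h2 := hM.marginal b (mem_univ b) fun _ => 1
    simp only [filter_true, if_true] at h1
    rw [h1, h2]
    simpa using sum_saLaw h0 (td.bags b)
  · obtain ⟨b, hi, hj⟩ := td.covers_edges i j hadj
    have h := hM.marginal b (mem_univ b) fun J => if (i ∈ J ↔ j ∈ J) then 0 else 1
    rw [hdiff, yNeq, add_div, ← sum_saLaw_pair y hadj.ne hi hj,
      ← sum_saLaw_pair y hadj.ne.symm hj hi, ← sum_add_distrib]
    calc ∑ x, M x * (if (i ∈ x (β i) ↔ j ∈ x (β j)) then (0 : ℝ) else 1)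
        = ∑ x, M x * (if (i ∈ x b ↔ j ∈ x b) then 0 else 1) := by
          refine sum_congr rfl fun x _ => ?_
          by_cases hx : M x = 0
          · rw [hx, zero_mul, zero_mul]
          · simp only [hM.mem_iff td.acyclic hy h0 hcard' (td.bags_connected i) (hβ i) hi hx,
              hM.mem_iff td.acyclic hy h0 hcard' (td.bags_connected j) (hβ j) hj hx]
      _ = _ := h
      _ = _ := by
          refine sum_congr rfl fun J _ => ?_
          by_cases h1 : i ∈ J <;> by_cases h2 : j ∈ J <;> simp [h1, h2]
  · have h1 := hM.pair_le hy h0 hcard hij (hβ i) (hβ j)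
    have h2 := hM.pair_le hy h0 hcard hij.symm (hβ j) (hβ i)
    simp only [iff_comm (a := j ∈ _)] at h2
    rw [hdiff, yNeq, add_div, one_div, inv_mul_le_iff₀ (by positivity)]
    rw [← hCdef] at h1 h2
    linarith
end

section
/- Let G = (V,E) be a graph on n vertices (identify V with {1,…,n}) with a tree decomposition (B, T) in which every bag has size at most t, and let y = (y_I) be a vector in SA_t(n) with y_∅ > 0. Then there exists a probability distribution over functions f : V → {0,1} such that for every bag B of the decomposition and every assignment g : B → {0,1}: Pr[f|_B = g] = ỹ_g. In particular, for every edge (i,j) ∈ E, Pr[f(i) ≠ f(j)] = ỹ_{i≠j}. -/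
open Finset

/-- The weight that `μ` gives to the functions agreeing with `g` on `S`. -/
def marginal {V : Type*} [Fintype V] [DecidableEq V] (μ : (V → Bool) → ℝ) (S : Finset V)
    (g : V → Bool) : ℝ :=
  ∑ f with ∀ x ∈ S, f x = g x, μ f

section Marginal

variable {V : Type*} [Fintype V] [DecidableEq V]

theorem marginal_congr (μ : (V → Bool) → ℝ) {S : Finset V} {g h : V → Bool}
    (hgh : ∀ x ∈ S, g x = h x) : marginal μ S g = marginal μ S h := by
  unfold marginal
  congr 1
  ext f
  simp only [mem_filter, mem_univ, true_and]
  exact forall₂_congr fun x hx => by rw [hgh x hx]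

theorem marginal_empty (μ : (V → Bool) → ℝ) (g : V → Bool) : marginal μ ∅ g = ∑ f, μ f := by
  simp [marginal]

theorem le_marginal {μ : (V → Bool) → ℝ} (hμ : ∀ f, 0 ≤ μ f) (S : Finset V) (g : V → Bool) :
    μ g ≤ marginal μ S g :=
  single_le_sum (f := μ) (fun f _ => hμ f) (by simp)

theorem marginal_insert (μ : (V → Bool) → ℝ) {S : Finset V} {x : V} (hx : x ∉ S)
    (g : V → Bool) :
    marginal μ S g = marginal μ (insert x S) (Function.update g x false) +
      marginal μ (insert x S) (Function.update g x true) := by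
  have key : ∀ b, marginal μ (insert x S) (Function.update g x b) =
      ∑ f with (∀ z ∈ S, f z = g z) ∧ f x = b, μ f := by
    intro b
    unfold marginal
    congr 1
    ext f
    simp only [mem_filter, mem_univ, true_and, forall_mem_insert, Function.update_self]
    rw [and_comm]
    refine and_congr_left fun _ => forall₂_congr fun z hz => ?_
    rw [Function.update_of_ne (ne_of_mem_of_not_mem hz hx)]
  rw [key, key, marginal, ← sum_filter_add_sum_filter_not _ (fun f => f x = false)]
  simp [filter_filter]

/-- A family of local weights satisfying the same marginalization rule as `marginal μ` and
agreeing with it on `B` agrees with it on all subsets of `B`. -/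
theorem marginal_eq_of_subset {μ : (V → Bool) → ℝ} {P : Finset V → (V → Bool) → ℝ}
    (hP : ∀ S x g, x ∉ S → P S g = P (insert x S) (Function.update g x false) +
      P (insert x S) (Function.update g x true))
    {S B : Finset V} (hSB : S ⊆ B) (h : ∀ g, marginal μ B g = P B g) (g : V → Bool) :
    marginal μ S g = P S g := by
  induction hd : #(B \ S) generalizing S g with
  | zero =>
    obtain rfl := hSB.antisymm (sdiff_eq_empty_iff_subset.1 (card_eq_zero.1 hd))
    exact h g
  | succ k ih =>
    obtain ⟨x, hx⟩ := card_pos.1 (by rw [hd]; exact k.succ_pos)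
    obtain ⟨hxB, hxS⟩ := mem_sdiff.1 hx
    have hcard : #(B \ insert x S) = k := by
      rw [sdiff_insert, card_erase_of_mem hx, hd, Nat.add_sub_cancel]
    have hsub := insert_subset hxB hSB
    rw [marginal_insert μ hxS, hP S x g hxS, ih hsub _ hcard, ih hsub _ hcard]

/-- Two nonnegative weights with the same marginals on `U ∩ W` can be glued. -/
theorem exists_marginal_eq_marginal {μ ν : (V → Bool) → ℝ} (hμ : ∀ f, 0 ≤ μ f)
    (hν : ∀ f, 0 ≤ ν f) (U W : Finset V)
    (h : ∀ g, marginal μ (U ∩ W) g = marginal ν (U ∩ W) g) :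
    ∃ ρ : (V → Bool) → ℝ, (∀ f, 0 ≤ ρ f) ∧ (∀ g, marginal ρ U g = marginal μ U g) ∧
      ∀ g, marginal ρ W g = marginal ν W g := by
  let agree : (V → Bool) → (V → Bool) → Prop := fun a b => ∀ x ∈ U ∩ W, b x = a x
  let glue : (V → Bool) → (V → Bool) → V → Bool := fun a b x => if x ∈ U then a x else b x
  let w : (V → Bool) → (V → Bool) → ℝ := fun a b =>
    if agree a b then μ a * ν b / marginal μ (U ∩ W) a else 0
  have hm : ∀ g, 0 ≤ marginal μ (U ∩ W) g := fun g => sum_nonneg fun f _ => hμ f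
  have hw : ∀ a b, 0 ≤ w a b := by
    intro a b
    dsimp only [w]
    split_ifs
    · exact div_nonneg (mul_nonneg (hμ a) (hν b)) (hm a)
    · exact le_rfl
  have hwa : ∀ a, ∑ b, w a b = μ a := by
    intro a
    have : ∑ b, w a b = μ a / marginal μ (U ∩ W) a * marginal ν (U ∩ W) a := by
      rw [marginal.eq_def ν, mul_sum, sum_filter]
      exact sum_congr rfl fun b _ => by dsimp only [w, agree]; split_ifs <;> ring
    rw [this, ← h]
    rcases (hm a).eq_or_lt with h0 | h0
    · rw [← h0, mul_zero]
      exact le_antisymm (hμ a) (h0 ▸ le_marginal hμ _ a)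
    · exact div_mul_cancel₀ _ h0.ne'
  have hwb : ∀ b, ∑ a, w a b = ν b := by
    intro b
    have : ∑ a, w a b = ν b / marginal μ (U ∩ W) b * marginal μ (U ∩ W) b := by
      nth_rewrite 2 [marginal]
      rw [mul_sum, sum_filter]
      refine sum_congr rfl fun a _ => ?_
      dsimp only [w, agree]
      by_cases hab : ∀ x ∈ U ∩ W, b x = a x
      · rw [if_pos hab, if_pos fun x hx => (hab x hx).symm, marginal_congr μ hab]
        ring
      · rw [if_neg hab, if_neg fun h' => hab fun x hx => (h' x hx).symm]
    rw [this]
    rcases (hm b).eq_or_lt with h0 | h0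
    · rw [← h0, mul_zero]
      exact le_antisymm (hν b) (h0 ▸ h b ▸ le_marginal hν _ b)
    · exact div_mul_cancel₀ _ h0.ne'
  have hρ : ∀ (S : Finset V) g, marginal (fun f => ∑ a, ∑ b, if glue a b = f then w a b else 0) S g
      = ∑ a, ∑ b, if ∀ x ∈ S, glue a b x = g x then w a b else 0 := by
    intro S g
    rw [marginal, sum_comm]
    refine sum_congr rfl fun a _ => ?_
    rw [sum_comm]
    refine sum_congr rfl fun b _ => ?_
    rw [sum_ite_eq]
    simp
  refine ⟨fun f => ∑ a, ∑ b, if glue a b = f then w a b else 0, fun f => ?_, fun g => ?_,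
    fun g => ?_⟩
  · exact sum_nonneg fun a _ => sum_nonneg fun b _ => by split_ifs <;> simp [hw]
  · rw [hρ, marginal, sum_filter]
    refine sum_congr rfl fun a _ => ?_
    have : ∀ b, (∀ x ∈ U, glue a b x = g x) ↔ ∀ x ∈ U, a x = g x := fun b =>
      forall₂_congr fun x hx => by simp [glue, hx]
    simp only [this]
    split_ifs
    · exact hwa a
    · simp
  · rw [hρ, sum_comm, marginal, sum_filter]
    refine sum_congr rfl fun b _ => ?_
    have : ∀ a, (if ∀ x ∈ W, glue a b x = g x then w a b else 0) =
        if ∀ x ∈ W, b x = g x then w a b else 0 := by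
      intro a
      by_cases hab : agree a b
      · congr 1
        refine propext (forall₂_congr fun x hx => ?_)
        by_cases hxU : x ∈ U
        · simp [glue, hxU, hab x (mem_inter.2 ⟨hxU, hx⟩)]
        · simp [glue, hxU]
      · simp [w, hab]
    simp only [this]
    split_ifs
    · exact hwb b
    · simp

/-- Any local weight on `B` is the marginal of some weight. -/
theorem exists_marginal_eq {p : (V → Bool) → ℝ} {B : Finset V} (hp : ∀ g, 0 ≤ p g)
    (hpB : ∀ g h, (∀ x ∈ B, g x = h x) → p g = p h) :
    ∃ ν : (V → Bool) → ℝ, (∀ f, 0 ≤ ν f) ∧ ∀ g, marginal ν B g = p g := by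
  refine ⟨fun f => if ∀ x ∉ B, f x = false then p f else 0,
    fun f => by dsimp only; split_ifs <;> simp [hp], fun g => ?_⟩
  rw [marginal, sum_eq_single (fun x => if x ∈ B then g x else false)]
  · rw [if_pos (by simp +contextual)]
    exact hpB _ _ (by simp +contextual)
  · intro f hf hne
    rw [if_neg]
    intro h
    refine hne (funext fun x => ?_)
    by_cases hx : x ∈ B
    · simpa [hx] using (mem_filter.1 hf).2 x hx
    · simpa [hx] using h x hx
  · simp +contextual

end Marginal

/-- In a tree decomposition, if `A` is a connected set of nodes with `j ∈ A`, and `i ∉ A` is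
adjacent to `j`, then the bag of `j` separates the bag of `i` from the bags of `A`. -/
theorem TreeDecomp.mem_bags_of_adj {V : Type} {G : SimpleGraph V} (td : TreeDecomp G)
    {A : Set td.ι} (hA : ∀ a ∈ A, ∀ b ∈ A, ∃ p : td.T.Walk a b, ∀ x ∈ p.support, x ∈ A)
    {i j : td.ι} (hi : i ∉ A) (hj : j ∈ A) (hij : td.T.Adj i j) {a : td.ι} (ha : a ∈ A) {v : V}
    (hvi : v ∈ td.bags i) (hva : v ∈ td.bags a) : v ∈ td.bags j := by
  classical
  obtain ⟨p, hp⟩ := hA j hj a ha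
  have hpath : (SimpleGraph.Walk.cons hij p.bypass).IsPath :=
    p.bypass_isPath.cons fun h => hi (hp i (p.support_bypass_subset_support h))
  obtain ⟨q⟩ := (td.bags_connected v).preconnected ⟨i, hvi⟩ ⟨a, hva⟩
  obtain ⟨q', hq'⟩ : ∃ q' : td.T.Walk i a, ∀ x ∈ q'.support, v ∈ td.bags x := by
    refine ⟨q.map (SimpleGraph.Embedding.induce _).toHom, fun x hx => ?_⟩
    obtain ⟨z, -, rfl⟩ := List.mem_map.1 ((SimpleGraph.Walk.support_map _ q) ▸ hx)
    exact z.2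
  have heq := (td.acyclic.subsingleton_path i a).elim ⟨_, hpath⟩ q'.toPath
  have hmem : j ∈ (SimpleGraph.Walk.cons hij p.bypass).support := by simp
  rw [Subtype.mk.injEq _ _ _ _ |>.mp heq] at hmem
  exact hq' j (q'.support_bypass_subset_support hmem)

/-- Consistent local weights on the bags of a tree decomposition come from a global weight. -/
theorem TreeDecomp.exists_marginal_eq {V : Type} [Fintype V] [DecidableEq V] {G : SimpleGraph V}
    (td : TreeDecomp G) {P : Finset V → (V → Bool) → ℝ}
    (hP : ∀ S x g, x ∉ S → P S g = P (insert x S) (Function.update g x false) +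
      P (insert x S) (Function.update g x true))
    (hPc : ∀ S g h, (∀ x ∈ S, g x = h x) → P S g = P S h)
    (hP0 : ∀ i g, 0 ≤ P (td.bags i) g) :
    ∃ μ : (V → Bool) → ℝ, (∀ f, 0 ≤ μ f) ∧ ∀ i g, marginal μ (td.bags i) g = P (td.bags i) g := by
  classical
  have := td.fintype_ι
  let good : Finset td.ι → Prop := fun A => A.Nonempty ∧
    (∀ a ∈ A, ∀ b ∈ A, ∃ p : td.T.Walk a b, ∀ x ∈ p.support, x ∈ A) ∧
    ∃ μ : (V → Bool) → ℝ, (∀ f, 0 ≤ μ f) ∧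
      ∀ i ∈ A, ∀ g, marginal μ (td.bags i) g = P (td.bags i) g
  have hne : (univ.filter good).Nonempty := by
    obtain ⟨r⟩ := td.connected.nonempty
    obtain ⟨ν, hν, hνP⟩ := _root_.exists_marginal_eq (hP0 r) (hPc (td.bags r))
    refine ⟨{r}, mem_filter.2 ⟨mem_univ _, singleton_nonempty r, ?_, ν, hν, ?_⟩⟩
    · simp only [mem_singleton]
      rintro a rfl b rfl
      exact ⟨.nil, by simp⟩
    · simpa using hνP
  obtain ⟨A, hA, hmax⟩ := exists_max_image _ Finset.card hne
  obtain ⟨⟨r, hr⟩, hconn, μ, hμ, hμP⟩ := (mem_filter.1 hA).2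
  by_cases hall : ∀ i, i ∈ A
  · exact ⟨μ, hμ, fun i => hμP i (hall i)⟩
  exfalso
  push Not at hall
  obtain ⟨s, hs⟩ := hall
  obtain ⟨w⟩ := td.connected.preconnected r s
  obtain ⟨d, -, hj, hi⟩ := w.exists_boundary_dart (A : Set td.ι) hr hs
  set j := d.fst
  set i := d.snd
  have hij : td.T.Adj i j := d.adj.symm
  obtain ⟨ν, hν, hνP⟩ := _root_.exists_marginal_eq (hP0 i) (hPc (td.bags i))
  have hsep : A.biUnion td.bags ∩ td.bags i ⊆ td.bags j := by
    intro v hv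
    obtain ⟨hvA, hvi⟩ := mem_inter.1 hv
    obtain ⟨a, ha, hva⟩ := mem_biUnion.1 hvA
    exact td.mem_bags_of_adj (A := A) hconn hi hj hij ha hvi hva
  obtain ⟨ρ, hρ, hρU, hρW⟩ := exists_marginal_eq_marginal hμ hν (A.biUnion td.bags) (td.bags i)
    fun g => by
      rw [marginal_eq_of_subset hP hsep (hμP j hj),
        marginal_eq_of_subset hP inter_subset_right hνP]
  have hgood : good (insert i A) := by
    refine ⟨insert_nonempty _ _, ?_, ρ, hρ, ?_⟩
    · have hi' : ∀ b ∈ A, ∃ p : td.T.Walk i b, ∀ x ∈ p.support, x ∈ insert i A := by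
        intro b hb
        obtain ⟨p, hp⟩ := hconn j hj b hb
        exact ⟨.cons hij p, by simpa using fun x hx => Or.inr (hp x hx)⟩
      intro a ha b hb
      rcases mem_insert.1 ha with rfl | ha <;> rcases mem_insert.1 hb with rfl | hb
      · exact ⟨.nil, by simp⟩
      · exact hi' b hb
      · obtain ⟨p, hp⟩ := hi' a ha
        exact ⟨p.reverse, by simpa using hp⟩
      · obtain ⟨p, hp⟩ := hconn a ha b hb
        exact ⟨p, fun x hx => mem_insert_of_mem (hp x hx)⟩
    · intro a ha g
      rcases mem_insert.1 ha with rfl | ha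
      · rw [hρW, hνP]
      · rw [← hμP a ha]
        exact marginal_eq_of_subset (P := marginal μ) (fun S x g hx => marginal_insert μ hx g)
          (subset_biUnion_of_mem td.bags ha) hρU g
  have := hmax _ (mem_filter.2 ⟨mem_univ _, hgood⟩)
  rw [card_insert_of_notMem hi] at this
  omega

theorem saIJ_insert {n : ℕ} (y : Finset (Fin n) → ℝ) {I : Finset (Fin n)} (J : Finset (Fin n))
    {x : Fin n} (hx : x ∉ I) : saIJ y I J = saIJ y (insert x I) J + saIJ y I (insert x J) := by
  unfold saIJ
  rw [sum_powerset_insert hx, add_assoc, ← sum_add_distrib, left_eq_add]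
  refine sum_eq_zero fun K hK => ?_
  rw [card_insert_of_notMem fun h => hx (mem_powerset.1 hK h), insert_union, union_insert]
  ring

/-- The weight `y_g` for `g` restricted to `S`. -/
def saWeight {n : ℕ} (y : Finset (Fin n) → ℝ) (S : Finset (Fin n)) (g : Fin n → Bool) : ℝ :=
  saIJ y {x ∈ S | g x = false} {x ∈ S | g x = true}

theorem saWeight_congr {n : ℕ} (y : Finset (Fin n) → ℝ) (S : Finset (Fin n))
    (g h : Fin n → Bool) (hgh : ∀ x ∈ S, g x = h x) : saWeight y S g = saWeight y S h := by
  unfold saWeight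
  congr 1 <;> exact filter_congr fun x hx => by rw [hgh x hx]

theorem saWeight_insert {n : ℕ} (y : Finset (Fin n) → ℝ) (S : Finset (Fin n)) (x : Fin n)
    (g : Fin n → Bool) (hx : x ∉ S) :
    saWeight y S g = saWeight y (insert x S) (Function.update g x false) +
      saWeight y (insert x S) (Function.update g x true) := by
  have key : ∀ b c, {z ∈ S | Function.update g x b z = c} = {z ∈ S | g z = c} := fun b c =>
    filter_congr fun z hz => by rw [Function.update_of_ne (ne_of_mem_of_not_mem hz hx)]
  simp only [saWeight, filter_insert, Function.update_self, key]
  simpa using saIJ_insert y _ (by simp [hx])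

theorem saWeight_nonneg {n t : ℕ} {y : Finset (Fin n) → ℝ} (hy : memSA t y)
    {S : Finset (Fin n)} (hS : S.card ≤ t) (g : Fin n → Bool) : 0 ≤ saWeight y S g :=
  hy _ _ ((card_le_card (union_subset (filter_subset _ _) (filter_subset _ _))).trans hS)

open scoped Classical in
/-- Lemma 2 of the paper: for a graph `G` with a tree decomposition all of
whose bags have size at most `t`, and `y ∈ SA_t(n)` with `y_∅ > 0`, there is a probability
distribution over `f : V → {0,1}` whose restriction to every bag `B` matches the local
distribution `μ_B` given by the LP, i.e. `Pr[f|_B = g] = ỹ_g = ỹ_{g⁻¹(0) ∩ B, g⁻¹(1) ∩ B}`.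
In particular every edge `(i,j)` is cut with probability exactly `ỹ_{i≠j}`. -/
theorem stmt3 (n t : ℕ) (hn : 1 ≤ n) (ht : 1 ≤ t)
    (G : SimpleGraph (Fin n)) (td : TreeDecomp G)
    (hbags : ∀ i, (td.bags i).card ≤ t)
    (y : Finset (Fin n) → ℝ) (hSA : memSA t y) (h0 : 0 < y ∅) :
    ∃ μ : (Fin n → Bool) → ℝ,
      (∀ f, 0 ≤ μ f) ∧ (∑ f, μ f = 1) ∧
      (∀ i : td.ι, ∀ g : Fin n → Bool,
        (∑ f ∈ Finset.univ.filter (fun f : Fin n → Bool => ∀ x ∈ td.bags i, f x = g x), μ f)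
          = saIJ y ((td.bags i).filter (fun x => g x = false))
              ((td.bags i).filter (fun x => g x = true)) / y ∅) ∧
      (∀ i j : Fin n, G.Adj i j →
        (∑ f ∈ Finset.univ.filter (fun f : Fin n → Bool => f i ≠ f j), μ f)
          = yNeq y i j / y ∅) := by
  obtain ⟨μ, hμ, hμP⟩ := td.exists_marginal_eq (saWeight_insert y) (saWeight_congr y)
    fun i => saWeight_nonneg hSA (hbags i)
  refine ⟨fun f => μ f / y ∅, fun f => div_nonneg (hμ f) h0.le, ?_, fun i g => ?_,
    fun i j hij => ?_⟩
  · obtain ⟨r⟩ := td.connected.nonempty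
    rw [← sum_div, ← marginal_empty μ fun _ => false,
      marginal_eq_of_subset (saWeight_insert y) (empty_subset _) (hμP r)]
    simpa [saWeight, saIJ] using div_self h0.ne'
  · rw [← sum_div]
    congr 1
    have h := hμP i g
    unfold marginal saWeight at h
    convert h
  · rw [← sum_div]
    congr 1
    obtain ⟨k, hik, hjk⟩ := td.covers_edges i j hij
    have hne : i ≠ j := hij.ne
    have hpair := marginal_eq_of_subset (S := {i, j}) (saWeight_insert y)
      (by simp [insert_subset_iff, hik, hjk]) (hμP k)
    have h₁ := hpair fun x => decide (x = j)
    have h₂ := hpair fun x => decide (x = i)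
    simp only [marginal, saWeight, filter_insert, filter_singleton, forall_mem_insert,
      mem_singleton, forall_eq, hne, hne.symm, decide_true, decide_false] at h₁ h₂
    simp at h₁ h₂
    rw [yNeq, ← h₁, ← h₂, ← sum_filter_add_sum_filter_not _ (fun f => f i = false),
      filter_filter, filter_filter]
    congr 2 <;> ext f <;> cases hi : f i <;> cases hj : f j <;> simp [hi, hj]
end
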